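/- The set of maps f ∈ C_λ(I) that are locally eventually onto, whose set of periodic points Per(f) has full Lebesgue measure (λ(Per(f)) = 1), and for which λ(Per(f,k)) > 0 for every integer k ≥ 1, is dense in C_λ(I). -/

import Mathlib

open MeasureTheory Set Metric Filter Topology

noncomputable section

/-- Lebesgue measure on the unit interval `[0,1]`, viewed as a measure on the subtype. -/
def lebI : Measure unitInterval := (volume : Measure ℝ).comap Subtype.val

/-- A continuous self-map of `[0,1]` preserves Lebesgue measure. -/
def MeasPres (f : C(unitInterval, unitInterval)) : Prop :=
  ∀ A : Set unitInterval, MeasurableSet A → lebI (f ⁻¹' A) = lebI A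

/-- The space `C_λ(I)` of continuous Lebesgue-measure-preserving maps of `[0,1]`. -/
def CLam : Set C(unitInterval, unitInterval) := {f | MeasPres f}

/-- `Fix(f,k) = {x : f^k x = x}`. -/
def FixSet {X : Type*} (f : X → X) (k : ℕ) : Set X := {x | f^[k] x = x}

/-- `Per(f,k) = {x : f^k x = x and f^i x ≠ x for 1 ≤ i < k}`. -/
def PerSet {X : Type*} (f : X → X) (k : ℕ) : Set X :=
  {x | f^[k] x = x ∧ ∀ i : ℕ, 1 ≤ i → i < k → f^[i] x ≠ x}

/-- `Per(f) = ⋃_{k ≥ 1} Fix(f,k)`, the set of all periodic points. -/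
def PerAll {X : Type*} (f : X → X) : Set X := ⋃ k ∈ {k : ℕ | 1 ≤ k}, FixSet f k

/-- A Cantor set: nonempty, compact, perfect and totally disconnected. -/
def IsCantorSet {X : Type*} [TopologicalSpace X] (C : Set X) : Prop :=
  C.Nonempty ∧ IsCompact C ∧ Perfect C ∧ IsTotallyDisconnected C

/-- `f` is locally eventually onto: for every nonempty open interval `J ⊆ [0,1]`
there is `n ≥ 0` with `f^n(J) = [0,1]`. -/
def Leo (f : unitInterval → unitInterval) : Prop :=
  ∀ J : Set unitInterval, J.OrdConnected → IsOpen J → J.Nonempty →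
    ∃ n : ℕ, f^[n] '' J = Set.univ

/-- The zigzag operator: it replaces a monotone transition of `F` from `0` to `1` by three laps,
each made of two half-size copies of `F`. -/
def zig (F : ℝ → ℝ) (x : ℝ) : ℝ :=
  (F (6 * x) + F (6 * x - 1) - F (6 * x - 2) - F (6 * x - 3) + F (6 * x - 4) + F (6 * x - 5)) / 2

/-- Functions that are `0` left of `0`, `1` right of `1`, and take values in `[0,1]`. -/
def IsStep (F : ℝ → ℝ) : Prop :=
  (∀ x ≤ 0, F x = 0) ∧ (∀ x, 1 ≤ x → F x = 1) ∧ ∀ x, 0 ≤ F x ∧ F x ≤ 1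

lemma IsStep.zig {F : ℝ → ℝ} (h : IsStep F) : IsStep (zig F) := by
  obtain ⟨h0, h1, h2⟩ := h
  refine ⟨fun x hx => ?_, fun x hx => ?_, fun x => ?_⟩
  · unfold _root_.zig
    rw [h0 (6 * x) (by linarith), h0 (6 * x - 1) (by linarith), h0 (6 * x - 2) (by linarith),
      h0 (6 * x - 3) (by linarith), h0 (6 * x - 4) (by linarith), h0 (6 * x - 5) (by linarith)]
    norm_num
  · unfold _root_.zig
    rw [h1 (6 * x) (by linarith), h1 (6 * x - 1) (by linarith), h1 (6 * x - 2) (by linarith),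
      h1 (6 * x - 3) (by linarith), h1 (6 * x - 4) (by linarith), h1 (6 * x - 5) (by linarith)]
    norm_num
  · unfold _root_.zig
    have a0 := h2 (6 * x)
    have a1 := h2 (6 * x - 1)
    have a2 := h2 (6 * x - 2)
    have a3 := h2 (6 * x - 3)
    have a4 := h2 (6 * x - 4)
    have a5 := h2 (6 * x - 5)
    rcases le_total (6 * x) 2 with c | c
    · rw [h0 (6 * x - 2) (by linarith), h0 (6 * x - 3) (by linarith), h0 (6 * x - 4) (by linarith),
        h0 (6 * x - 5) (by linarith)]
      constructor <;> linarith
    · rw [h1 (6 * x) (by linarith), h1 (6 * x - 1) (by linarith)]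
      rcases le_total (6 * x) 4 with c | c
      · rw [h0 (6 * x - 4) (by linarith), h0 (6 * x - 5) (by linarith)]
        constructor <;> linarith
      · rw [h1 (6 * x - 2) (by linarith), h1 (6 * x - 3) (by linarith)]
        constructor <;> linarith

lemma IsStep.abs_zig_sub_le {F H : ℝ → ℝ} (hF : IsStep F) (hH : IsStep H) {d : ℝ}
    (hd : ∀ x, |F x - H x| ≤ d) (x : ℝ) : |_root_.zig F x - _root_.zig H x| ≤ d / 2 := by
  have hl : ∀ t ≤ 0, F t = H t := fun t ht => (hF.1 t ht).trans (hH.1 t ht).symm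
  have hr : ∀ t, 1 ≤ t → F t = H t := fun t ht => (hF.2.1 t ht).trans (hH.2.1 t ht).symm
  unfold _root_.zig
  have a0 := abs_le.1 (hd (6 * x))
  have a1 := abs_le.1 (hd (6 * x - 1))
  have a2 := abs_le.1 (hd (6 * x - 2))
  have a3 := abs_le.1 (hd (6 * x - 3))
  have a4 := abs_le.1 (hd (6 * x - 4))
  have a5 := abs_le.1 (hd (6 * x - 5))
  rw [abs_le]
  rcases le_total (6 * x) 1 with c | c
  · rw [hl (6 * x - 1) (by linarith), hl (6 * x - 2) (by linarith), hl (6 * x - 3) (by linarith),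
      hl (6 * x - 4) (by linarith), hl (6 * x - 5) (by linarith)]
    constructor <;> linarith
  rw [hr (6 * x) (by linarith)]
  rcases le_total (6 * x) 2 with c | c
  · rw [hl (6 * x - 2) (by linarith), hl (6 * x - 3) (by linarith),
      hl (6 * x - 4) (by linarith), hl (6 * x - 5) (by linarith)]
    constructor <;> linarith
  rw [hr (6 * x - 1) (by linarith)]
  rcases le_total (6 * x) 3 with c | c
  · rw [hl (6 * x - 3) (by linarith), hl (6 * x - 4) (by linarith), hl (6 * x - 5) (by linarith)]
    constructor <;> linarith
  rw [hr (6 * x - 2) (by linarith)]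
  rcases le_total (6 * x) 4 with c | c
  · rw [hl (6 * x - 4) (by linarith), hl (6 * x - 5) (by linarith)]
    constructor <;> linarith
  rw [hr (6 * x - 3) (by linarith)]
  rcases le_total (6 * x) 5 with c | c
  · rw [hl (6 * x - 5) (by linarith)]
    constructor <;> linarith
  rw [hr (6 * x - 4) (by linarith)]
  constructor <;> linarith

/-- The zigzag operator has a continuous fixed point. -/
lemma exists_zig_fixed : ∃ F : ℝ → ℝ, Continuous F ∧ IsStep F ∧ ∀ x, zig F x = F x := by
  let F0 : ℝ → ℝ := fun x => max 0 (min x 1)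
  have hF0 : IsStep F0 := by
    refine ⟨fun x hx => ?_, fun x hx => ?_, fun x => ⟨le_max_left _ _, ?_⟩⟩
    · exact max_eq_left (min_le_of_left_le hx)
    · simp [F0, hx]
    · simp [F0]
  have hstep : ∀ n, IsStep (zig^[n] F0) := by
    intro n
    induction n with
    | zero => exact hF0
    | succ n ih => rw [Function.iterate_succ_apply']; exact ih.zig
  have hcont : ∀ n, Continuous (zig^[n] F0) := by
    intro n
    induction n with
    | zero => exact continuous_const.max (continuous_id.min continuous_const)
    | succ n ih => rw [Function.iterate_succ_apply']; unfold zig; fun_prop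
  have hdist : ∀ n x, |zig^[n] F0 x - zig^[n + 1] F0 x| ≤ (1 / 2) ^ n := by
    intro n
    induction n with
    | zero =>
      intro x
      have h1 := (hstep 0).2.2 x
      have h2 := (hstep 1).2.2 x
      rw [abs_le]
      constructor <;> norm_num at * <;> linarith
    | succ n ih =>
      intro x
      rw [Function.iterate_succ_apply' (n := n), Function.iterate_succ_apply' (n := n + 1)]
      refine ((hstep n).abs_zig_sub_le (hstep (n + 1)) ih x).trans ?_
      rw [pow_succ]; linarith
  have hcs : ∀ x, CauchySeq fun n => zig^[n] F0 x := fun x =>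
    cauchySeq_of_le_geometric (1 / 2) 1 (by norm_num)
      (fun n => by rw [Real.dist_eq, one_mul]; exact hdist n x)
  choose F hF using fun x => cauchySeq_tendsto_of_complete (hcs x)
  have hunif : ∀ n x, dist (zig^[n] F0 x) (F x) ≤ 2 * (1 / 2) ^ n := by
    intro n x
    have := dist_le_of_le_geometric_of_tendsto (1 / 2) 1 (by norm_num)
      (fun n => by rw [Real.dist_eq, one_mul]; exact hdist n x) (hF x) n
    refine this.trans (le_of_eq (by ring))
  refine ⟨F, ?_, ?_, ?_⟩
  · refine TendstoUniformly.continuous (F := fun n => zig^[n] F0) (p := atTop) ?_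
      (Eventually.of_forall hcont).frequently
    rw [Metric.tendstoUniformly_iff]
    intro ε hε
    have : Tendsto (fun n : ℕ => 2 * (1 / 2 : ℝ) ^ n) atTop (𝓝 (2 * 0)) :=
      (tendsto_pow_atTop_nhds_zero_of_lt_one (by norm_num) (by norm_num)).const_mul 2
    filter_upwards [this.eventually_lt_const (by simpa using hε)] with n hn x
    rw [dist_comm]
    exact (hunif n x).trans_lt hn
  · refine ⟨fun x hx => ?_, fun x hx => ?_, fun x => ⟨?_, ?_⟩⟩
    · exact tendsto_nhds_unique (hF x) (by simp [fun n => (hstep n).1 x hx])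
    · exact tendsto_nhds_unique (hF x) (by simp [fun n => (hstep n).2.1 x hx])
    · exact ge_of_tendsto' (hF x) fun n => ((hstep n).2.2 x).1
    · exact le_of_tendsto' (hF x) fun n => ((hstep n).2.2 x).2
  · intro x
    have h1 : Tendsto (fun n => zig^[n + 1] F0 x) atTop (𝓝 (zig F x)) := by
      simp only [Function.iterate_succ_apply']
      unfold zig
      exact ((((((hF _).add (hF _)).sub (hF _)).sub (hF _)).add (hF _)).add (hF _)).div_const 2
    exact tendsto_nhds_unique h1 ((tendsto_add_atTop_iff_nat 1).2 (hF x))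

/-- A self-affine zigzag function climbing from `0` to `1`. -/
def zigzag : ℝ → ℝ := Classical.choose exists_zig_fixed

lemma continuous_zigzag : Continuous zigzag := (Classical.choose_spec exists_zig_fixed).1

lemma isStep_zigzag : IsStep zigzag := (Classical.choose_spec exists_zig_fixed).2.1

lemma zig_zigzag (x : ℝ) : zig zigzag x = zigzag x :=
  (Classical.choose_spec exists_zig_fixed).2.2 x

/-- The profile of `zigzag` at the points `t / 6`, in units of `1 / 2`. -/
def wave (t : ℤ) : ℤ :=
  if t = 1 then 1 else if t = 2 then 2 else if t = 3 then 1 else if t = 5 then 1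
  else if t = 6 then 2 else 0

/-- The continuous map taking the value `y i / M` at `i / M`, with a copy of `zigzag` in between. -/
def gridMap (M : ℕ) (y : ℤ → ℤ) (x : ℝ) : ℝ :=
  (y 0 + ∑ i ∈ Finset.range M, ((y (i + 1) - y i : ℤ) : ℝ) * zigzag (M * x - i)) / M

/-- The values of `gridMap M y` on the six times finer grid, in units of that grid. -/
def refineNodes (y : ℤ → ℤ) (a : ℤ) : ℤ :=
  6 * y (a / 6) + 3 * (y (a / 6 + 1) - y (a / 6)) * wave (a % 6)

/-- Admissible node sequences: values in `[0, M]`, and consecutive values are distinct. -/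
def IsNodes (M : ℕ) (y : ℤ → ℤ) : Prop :=
  0 < M ∧ (∀ i : ℤ, 0 ≤ i → i ≤ M → 0 ≤ y i ∧ y i ≤ M) ∧ ∀ i : ℤ, 0 ≤ i → i < M → y i ≠ y (i + 1)

/-- The image of the cell `i` covers the cell `j`. -/
def Arrow (y : ℤ → ℤ) (i j : ℤ) : Prop := min (y i) (y (i + 1)) ≤ j ∧ j < max (y i) (y (i + 1))

/-- The `i`-th closed cell of the grid of mesh `1 / M`. -/
def cell (M : ℕ) (i : ℤ) : Set ℝ := Icc ((i : ℝ) / M) ((i + 1 : ℝ) / M)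

lemma refineNodes_apply (y : ℤ → ℤ) (i t : ℤ) (h0 : 0 ≤ t) (h6 : t ≤ 6) :
    refineNodes y (6 * i + t) = 6 * y i + 3 * (y (i + 1) - y i) * wave t := by
  rcases h6.lt_or_eq with h | rfl
  · have e1 : (6 * i + t) / 6 = i := by omega
    have e2 : (6 * i + t) % 6 = t := by omega
    rw [refineNodes, e1, e2]
  · have e1 : (6 * i + 6) / 6 = i + 1 := by omega
    have e2 : (6 * i + 6) % 6 = 0 := by omega
    rw [refineNodes, e1, e2]
    simp only [wave]
    norm_num
    ring

lemma refineNodes_values (y : ℤ → ℤ) (i : ℤ) :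
    refineNodes y (6 * i) = 6 * y i ∧ refineNodes y (6 * i + 1) = 3 * y i + 3 * y (i + 1) ∧
    refineNodes y (6 * i + 2) = 6 * y (i + 1) ∧
    refineNodes y (6 * i + 3) = 3 * y i + 3 * y (i + 1) ∧
    refineNodes y (6 * i + 4) = 6 * y i ∧
    refineNodes y (6 * i + 5) = 3 * y i + 3 * y (i + 1) ∧
    refineNodes y (6 * i + 6) = 6 * y (i + 1) := by
  have h0 := refineNodes_apply y i 0 (by norm_num) (by norm_num)
  rw [add_zero] at h0
  rw [h0, refineNodes_apply y i 1 (by norm_num) (by norm_num),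
    refineNodes_apply y i 2 (by norm_num) (by norm_num),
    refineNodes_apply y i 3 (by norm_num) (by norm_num),
    refineNodes_apply y i 4 (by norm_num) (by norm_num),
    refineNodes_apply y i 5 (by norm_num) (by norm_num),
    refineNodes_apply y i 6 (by norm_num) (by norm_num)]
  simp only [wave]
  norm_num
  refine ⟨?_, ?_, ?_, ?_⟩ <;> ring

lemma IsNodes.refine {M : ℕ} {y : ℤ → ℤ} (h : IsNodes M y) :
    IsNodes (6 * M) (refineNodes y) := by
  obtain ⟨hM, hr, hne⟩ := h
  refine ⟨by omega, fun a h0 h1 => ?_, fun a h0 h1 => ?_⟩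
  · push_cast at h1
    rcases h1.lt_or_eq with h1 | h1
    · obtain ⟨i, t, rfl, ht⟩ : ∃ i t : ℤ, a = 6 * i + t ∧ (t = 0 ∨ t = 1 ∨ t = 2 ∨ t = 3 ∨
          t = 4 ∨ t = 5) := ⟨a / 6, a % 6, by omega, by omega⟩
      have a1 := hr i (by omega) (by omega)
      have a2 := hr (i + 1) (by omega) (by omega)
      obtain ⟨v0, v1, v2, v3, v4, v5, -⟩ := refineNodes_values y i
      rcases ht with rfl | rfl | rfl | rfl | rfl | rfl <;> push_cast <;> try rw [add_zero]
      all_goals omega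
    · have a1 := hr M (by omega) (by omega)
      obtain ⟨v0, -⟩ := refineNodes_values y M
      rw [h1, v0]
      push_cast
      omega
  · push_cast at h1
    obtain ⟨i, t, rfl, ht⟩ : ∃ i t : ℤ, a = 6 * i + t ∧ (t = 0 ∨ t = 1 ∨ t = 2 ∨ t = 3 ∨
        t = 4 ∨ t = 5) := ⟨a / 6, a % 6, by omega, by omega⟩
    have a1 := hne i (by omega) (by omega)
    obtain ⟨v0, v1, v2, v3, v4, v5, v6⟩ := refineNodes_values y i
    rcases ht with rfl | rfl | rfl | rfl | rfl | rfl <;> (try rw [add_zero]) <;>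
      (try rw [add_assoc]) <;> norm_num <;> omega

lemma sum_range_six_mul (F : ℕ → ℝ) (M : ℕ) :
    ∑ a ∈ Finset.range (6 * M), F a = ∑ i ∈ Finset.range M, (F (6 * i) + F (6 * i + 1) +
      F (6 * i + 2) + F (6 * i + 3) + F (6 * i + 4) + F (6 * i + 5)) := by
  induction M with
  | zero => simp
  | succ M ih =>
    rw [Finset.sum_range_succ, ← ih, mul_add_one]
    simp only [Finset.sum_range_succ]
    ring

lemma gridMap_refine (M : ℕ) (y : ℤ → ℤ) : gridMap (6 * M) (refineNodes y) = gridMap M y := by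
  funext x
  have key : (refineNodes y 0 + ∑ a ∈ Finset.range (6 * M),
      ((refineNodes y (a + 1) - refineNodes y a : ℤ) : ℝ) * zigzag ((6 * M : ℕ) * x - a) : ℝ) =
      6 * (y 0 + ∑ i ∈ Finset.range M, ((y (i + 1) - y i : ℤ) : ℝ) * zigzag (M * x - i)) := by
    rw [sum_range_six_mul, mul_add, Finset.mul_sum]
    congr 1
    · have := (refineNodes_values y 0).1
      norm_num at this
      rw [this]; push_cast; ring
    · refine Finset.sum_congr rfl fun i _ => ?_
      obtain ⟨v0, v1, v2, v3, v4, v5, v6⟩ := refineNodes_values y i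
      rw [← zig_zigzag (M * x - i), zig]
      push_cast
      simp only [add_assoc]
      norm_num
      rw [v0, v1, v2, v3, v4, v5, v6]
      have e : 6 * ((M : ℝ) * x - i) = 6 * M * x - 6 * i := by ring
      rw [e]
      simp only [← sub_sub]
      push_cast
      ring
  rw [gridMap, gridMap, key]
  push_cast
  rw [mul_div_mul_left _ _ (by norm_num)]

lemma continuous_gridMap (M : ℕ) (y : ℤ → ℤ) : Continuous (gridMap M y) := by
  have := continuous_zigzag
  unfold gridMap
  fun_prop

lemma sum_range_sub_int (y : ℤ → ℤ) (k : ℕ) :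
    ∑ i ∈ Finset.range k, ((y (i + 1) - y i : ℤ) : ℝ) = y k - y 0 := by
  have := Finset.sum_range_sub (fun i : ℕ => (y i : ℝ)) k
  push_cast at this ⊢
  exact this

/-- The explicit value of `gridMap` in each cell. -/
lemma gridMap_of_mem_cell {M : ℕ} (hM : 0 < M) (y : ℤ → ℤ) {i : ℤ} (h0 : 0 ≤ i) (h1 : i < M)
    {x : ℝ} (hx : x ∈ cell M i) :
    gridMap M y x = (y i + ((y (i + 1) - y i : ℤ) : ℝ) * zigzag (M * x - i)) / M := by
  lift i to ℕ using h0
  have hM' : (0 : ℝ) < M := by exact_mod_cast hM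
  obtain ⟨ha, hb⟩ := hx
  rw [div_le_iff₀ hM'] at ha
  rw [le_div_iff₀ hM'] at hb
  push_cast at ha hb
  rw [gridMap]
  congr 1
  have hi : i < M := by exact_mod_cast h1
  rw [Finset.range_eq_Ico, ← Finset.sum_Ico_consecutive _ (Nat.zero_le i) hi.le,
    Finset.sum_eq_sum_Ico_succ_bot hi, ← Finset.range_eq_Ico]
  have e1 : ∑ j ∈ Finset.range i, ((y (j + 1) - y j : ℤ) : ℝ) * zigzag (M * x - j) =
      y i - y 0 := by
    rw [← sum_range_sub_int]
    refine Finset.sum_congr rfl fun j hj => ?_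
    have hj' : (j : ℝ) + 1 ≤ i := by exact_mod_cast Finset.mem_range.1 hj
    rw [isStep_zigzag.2.1 _ (by linarith), mul_one]
  have e2 : ∑ j ∈ Finset.Ico (i + 1) M, ((y (j + 1) - y j : ℤ) : ℝ) * zigzag (M * x - j) = 0 := by
    refine Finset.sum_eq_zero fun j hj => ?_
    have hj' : (i : ℝ) + 1 ≤ j := by exact_mod_cast (Finset.mem_Ico.1 hj).1
    rw [isStep_zigzag.1 _ (by linarith), mul_zero]
  rw [e1, e2]
  push_cast
  ring

lemma gridMap_left {M : ℕ} (hM : 0 < M) (y : ℤ → ℤ) {i : ℤ} (h0 : 0 ≤ i) (h1 : i < M) :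
    gridMap M y (i / M) = y i / M := by
  have hM' : (0 : ℝ) < M := by exact_mod_cast hM
  rw [gridMap_of_mem_cell hM y h0 h1 ⟨le_rfl, by gcongr; linarith⟩, isStep_zigzag.1]
  · simp
  · rw [mul_div_cancel₀ _ hM'.ne', sub_self]

lemma gridMap_right {M : ℕ} (hM : 0 < M) (y : ℤ → ℤ) {i : ℤ} (h0 : 0 ≤ i) (h1 : i < M) :
    gridMap M y ((i + 1) / M) = y (i + 1) / M := by
  have hM' : (0 : ℝ) < M := by exact_mod_cast hM
  rw [gridMap_of_mem_cell hM y h0 h1 ⟨by gcongr; linarith, le_rfl⟩, isStep_zigzag.2.1]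
  · push_cast; ring_nf
  · rw [mul_div_cancel₀ _ hM'.ne']; linarith

lemma gridMap_mem_Icc {M : ℕ} (hM : 0 < M) (y : ℤ → ℤ) {i : ℤ} (h0 : 0 ≤ i) (h1 : i < M)
    {x : ℝ} (hx : x ∈ cell M i) :
    gridMap M y x ∈ Icc (((min (y i) (y (i + 1)) : ℤ) : ℝ) / M)
      (((max (y i) (y (i + 1)) : ℤ) : ℝ) / M) := by
  rw [gridMap_of_mem_cell hM y h0 h1 hx]
  obtain ⟨z0, z1⟩ := isStep_zigzag.2.2 (M * x - i)
  push_cast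
  constructor
  · gcongr
    rcases le_total (y i : ℝ) (y (i + 1)) with h | h
    · rw [min_eq_left h]; nlinarith
    · rw [min_eq_right h]; nlinarith
  · gcongr
    rcases le_total (y i : ℝ) (y (i + 1)) with h | h
    · rw [max_eq_right h]; nlinarith
    · rw [max_eq_left h]; nlinarith

lemma exists_cell {M : ℕ} (hM : 0 < M) {x : ℝ} (h0 : 0 ≤ x) (h1 : x ≤ 1) :
    ∃ i : ℤ, 0 ≤ i ∧ i < M ∧ x ∈ cell M i := by
  have hM' : (0 : ℝ) < M := by exact_mod_cast hM
  rcases h1.lt_or_eq with h1 | rfl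
  · refine ⟨⌊(M : ℝ) * x⌋, Int.floor_nonneg.2 (by positivity), ?_, ?_, ?_⟩
    · rw [Int.floor_lt]; push_cast; nlinarith
    · rw [div_le_iff₀ hM', mul_comm]; exact Int.floor_le _
    · rw [le_div_iff₀ hM', mul_comm]; exact (Int.lt_floor_add_one _).le
  · refine ⟨M - 1, by omega, by omega, ?_, ?_⟩
    · rw [div_le_iff₀ hM']; push_cast; linarith
    · rw [le_div_iff₀ hM']; push_cast; linarith

lemma cell_subset_unit {M : ℕ} (hM : 0 < M) {i : ℤ} (h0 : 0 ≤ i) (h1 : i < M) :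
    cell M i ⊆ Icc 0 1 := by
  have hM' : (0 : ℝ) < M := by exact_mod_cast hM
  have h0' : (0 : ℝ) ≤ i := by exact_mod_cast h0
  have h1' : (i : ℝ) + 1 ≤ M := by exact_mod_cast h1
  refine Icc_subset_Icc (by positivity) ?_
  rw [div_le_one hM']; exact h1'

lemma gridMap_mem_unit {M : ℕ} {y : ℤ → ℤ} (h : IsNodes M y) {x : ℝ} (hx : x ∈ Icc (0 : ℝ) 1) :
    gridMap M y x ∈ Icc (0 : ℝ) 1 := by
  obtain ⟨hM, hr, -⟩ := h
  have hM' : (0 : ℝ) < M := by exact_mod_cast hM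
  obtain ⟨i, h0, h1, hi⟩ := exists_cell hM hx.1 hx.2
  obtain ⟨ha, hb⟩ := gridMap_mem_Icc hM y h0 h1 hi
  have a1 := hr i (by omega) (by omega)
  have a2 := hr (i + 1) (by omega) (by omega)
  refine ⟨le_trans ?_ ha, hb.trans ?_⟩
  · have : (0 : ℤ) ≤ min (y i) (y (i + 1)) := by omega
    have : (0 : ℝ) ≤ ((min (y i) (y (i + 1)) : ℤ) : ℝ) := by exact_mod_cast this
    positivity
  · rw [div_le_one hM']
    have : max (y i) (y (i + 1)) ≤ (M : ℤ) := by omega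
    exact_mod_cast this

lemma cell_subset_image {M : ℕ} (hM : 0 < M) (y : ℤ → ℤ) {i j : ℤ} (h0 : 0 ≤ i) (h1 : i < M)
    (hij : Arrow y i j) : cell M j ⊆ gridMap M y '' cell M i := by
  have hM' : (0 : ℝ) < M := by exact_mod_cast hM
  have hle : (i : ℝ) / M ≤ (i + 1) / M := by gcongr; linarith
  obtain ⟨ha, hb⟩ := hij
  have hsub : ∀ u v : ℤ, u ≤ j → j < v →
      cell M j ⊆ Icc ((u : ℝ) / M) ((v : ℝ) / M) := by
    intro u v hu hv
    have hu' : (u : ℝ) ≤ j := by exact_mod_cast hu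
    have hv' : (j : ℝ) + 1 ≤ v := by exact_mod_cast hv
    exact Icc_subset_Icc (by gcongr) (by gcongr)
  rcases le_total (y i) (y (i + 1)) with h | h
  · refine (hsub (y i) (y (i + 1)) (by omega) (by omega)).trans ?_
    have := intermediate_value_Icc hle (continuous_gridMap M y).continuousOn
    rwa [gridMap_left hM y h0 h1, gridMap_right hM y h0 h1] at this
  · refine (hsub (y (i + 1)) (y i) (by omega) (by omega)).trans ?_
    have := intermediate_value_Icc' hle (continuous_gridMap M y).continuousOn
    rwa [gridMap_left hM y h0 h1, gridMap_right hM y h0 h1] at this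

/-- `Reach y k i j`: there is a chain of `k` arrows from `i` to `j`. -/
def Reach (y : ℤ → ℤ) : ℕ → ℤ → ℤ → Prop
  | 0, i, j => i = j
  | k + 1, i, j => ∃ l, Reach y k i l ∧ Arrow y l j

/-- Every cell reaches all cells in the same positive number of steps. -/
def Primitive (M : ℕ) (y : ℤ → ℤ) : Prop :=
  ∀ i : ℤ, 0 ≤ i → i < M → ∃ k, 0 < k ∧ ∀ j : ℤ, 0 ≤ j → j < M → Reach y k i j

lemma Arrow.mem {M : ℕ} {y : ℤ → ℤ} (h : IsNodes M y) {i j : ℤ} (h0 : 0 ≤ i) (h1 : i < M)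
    (hij : Arrow y i j) : 0 ≤ j ∧ j < M := by
  have a1 := h.2.1 i (by omega) (by omega)
  have a2 := h.2.1 (i + 1) (by omega) (by omega)
  obtain ⟨h2, h3⟩ := hij
  omega

lemma Reach.mem {M : ℕ} {y : ℤ → ℤ} (h : IsNodes M y) {i : ℤ} (h0 : 0 ≤ i) (h1 : i < M) :
    ∀ {k : ℕ} {j : ℤ}, Reach y k i j → 0 ≤ j ∧ j < M
  | 0, _, hr => by cases hr; exact ⟨h0, h1⟩
  | _ + 1, _, ⟨_, hl, ha⟩ => ha.mem h (Reach.mem h h0 h1 hl).1 (Reach.mem h h0 h1 hl).2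

/-- Each lap of the refined cell covers whatever the original cell covers. -/
lemma arrow_refine_lap (y : ℤ → ℤ) {p i j b : ℤ} (hp : p / 3 = i) (hij : Arrow y i j)
    (hb : b / 6 = j) :
    Arrow (refineNodes y) (2 * p) b ∨ Arrow (refineNodes y) (2 * p + 1) b := by
  obtain ⟨v0, v1, v2, v3, v4, v5, v6⟩ := refineNodes_values y i
  obtain ⟨ha, hb'⟩ := hij
  have hp' : 2 * p = 6 * i ∨ 2 * p = 6 * i + 2 ∨ 2 * p = 6 * i + 4 := by omega
  unfold Arrow
  rcases hp' with hp' | hp' | hp' <;> rw [hp'] <;> simp only [add_assoc] <;> norm_num <;>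
    simp only [v0, v1, v2, v3, v4, v5, v6] <;> omega

lemma Primitive.refine {M : ℕ} {y : ℤ → ℤ} (h : IsNodes M y) (hp : Primitive M y) :
    Primitive (6 * M) (refineNodes y) := by
  intro a h0 h1
  have h' := h.refine
  obtain ⟨A, B, hAB, hA⟩ : ∃ A B : ℤ, A + 3 ≤ B ∧ ∀ b, A ≤ b → b < B →
      Arrow (refineNodes y) a b := by
    refine ⟨min (refineNodes y a) (refineNodes y (a + 1)),
      max (refineNodes y a) (refineNodes y (a + 1)), ?_, fun b hb hb' => ⟨hb, hb'⟩⟩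
    push_cast at h1
    have hne := h.2.2 (a / 6) (by omega) (by omega)
    obtain ⟨v0, v1, v2, v3, v4, v5, v6⟩ := refineNodes_values y (a / 6)
    have ha : a = 6 * (a / 6) ∨ a = 6 * (a / 6) + 1 ∨ a = 6 * (a / 6) + 2 ∨ a = 6 * (a / 6) + 3 ∨
      a = 6 * (a / 6) + 4 ∨ a = 6 * (a / 6) + 5 := by omega
    generalize a / 6 = i at *
    rcases ha with rfl | rfl | rfl | rfl | rfl | rfl <;> (try simp only [add_assoc]) <;> norm_num <;>
      simp only [v0, v1, v2, v3, v4, v5, v6] <;> omega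
  obtain ⟨p, hp1, hp2⟩ : ∃ p, A ≤ 2 * p ∧ 2 * p + 1 < B := ⟨(A + 1) / 2, by omega, by omega⟩
  have hpa := hA (2 * p) hp1 (by omega)
  have hpa' := hA (2 * p + 1) (by omega) hp2
  have hpm := hpa.mem h' h0 h1
  push_cast at hpm
  have hi0 : 0 ≤ p / 3 := by omega
  have hi1 : p / 3 < M := by omega
  obtain ⟨j₀, hj₀⟩ : ∃ j₀, Arrow y (p / 3) j₀ := by
    have hne := h.2.2 (p / 3) hi0 hi1
    exact ⟨min (y (p / 3)) (y (p / 3 + 1)), le_rfl, by omega⟩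
  obtain ⟨hj0, hj1⟩ := hj₀.mem h hi0 hi1
  have hblock : ∀ k j, Reach y k j₀ j → ∀ b, b / 6 = j → Reach (refineNodes y) (k + 2) a b := by
    intro k
    induction k with
    | zero =>
      rintro j rfl b hb
      rcases arrow_refine_lap y rfl hj₀ hb with hh | hh
      · exact ⟨2 * p, ⟨a, rfl, hpa⟩, hh⟩
      · exact ⟨2 * p + 1, ⟨a, rfl, hpa'⟩, hh⟩
    | succ k ih =>
      rintro j ⟨l, hl, hlj⟩ b hb
      rcases arrow_refine_lap y (p := 3 * l) (by omega) hlj hb with hh | hh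
      · exact ⟨_, ih l hl _ (by omega), hh⟩
      · exact ⟨_, ih l hl _ (by omega), hh⟩
  obtain ⟨k, -, hk⟩ := hp j₀ hj0 hj1
  refine ⟨k + 2, by omega, fun b hb0 hb1 => hblock k (b / 6) ?_ b rfl⟩
  push_cast at hb1
  exact hk _ (by omega) (by omega)

lemma iterate_refine {M : ℕ} {y : ℤ → ℤ} (h : IsNodes M y) (n : ℕ) :
    IsNodes (6 ^ n * M) (refineNodes^[n] y) ∧
      gridMap (6 ^ n * M) (refineNodes^[n] y) = gridMap M y := by
  induction n with
  | zero => simpa using h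
  | succ n ih =>
    rw [Function.iterate_succ_apply', pow_succ', mul_assoc]
    exact ⟨ih.1.refine, (gridMap_refine _ _).trans ih.2⟩

lemma Primitive.iterate_refine {M : ℕ} {y : ℤ → ℤ} (h : IsNodes M y) (hp : Primitive M y)
    (n : ℕ) : Primitive (6 ^ n * M) (refineNodes^[n] y) := by
  induction n with
  | zero => simpa using hp
  | succ n ih =>
    rw [Function.iterate_succ_apply', pow_succ', mul_assoc]
    exact ih.refine (_root_.iterate_refine h n).1

lemma Reach.exists_path {M : ℕ} {y : ℤ → ℤ} (h : IsNodes M y) {i : ℤ} (h0 : 0 ≤ i) (h1 : i < M) :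
    ∀ {k : ℕ} {j : ℤ}, Reach y k i j → ∃ c : ℕ → ℤ, c 0 = i ∧ c k = j ∧
      ∀ t < k, 0 ≤ c t ∧ c t < M ∧ Arrow y (c t) (c (t + 1))
  | 0, j, hr => ⟨fun _ => i, rfl, hr, by simp⟩
  | k + 1, j, ⟨l, hl, ha⟩ => by
    obtain ⟨c, hc0, hck, hc⟩ := Reach.exists_path h h0 h1 hl
    have hm := hl.mem h h0 h1
    refine ⟨fun t => if t ≤ k then c t else j, by simpa using hc0, by simp, fun t ht => ?_⟩
    rcases (Nat.lt_succ_iff.1 ht).lt_or_eq with h' | rfl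
    · have e1 : t ≤ k := h'.le
      have e2 : t + 1 ≤ k := h'
      simpa only [e1, e2, if_true] using hc t h'
    · simpa [hck] using ⟨hm.1, hm.2, ha⟩

lemma Reach.cell_subset {M : ℕ} {y : ℤ → ℤ} (h : IsNodes M y) {i : ℤ} (h0 : 0 ≤ i)
    (h1 : i < M) : ∀ {k : ℕ} {j : ℤ}, Reach y k i j → cell M j ⊆ (gridMap M y)^[k] '' cell M i
  | 0, j, hr => by cases hr; simp
  | k + 1, j, ⟨l, hl, ha⟩ => by
    have hm := hl.mem h h0 h1
    rw [Function.iterate_succ', image_comp]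
    exact (cell_subset_image h.1 y hm.1 hm.2 ha).trans
      (image_mono (Reach.cell_subset h h0 h1 hl))

/-- A closed chain of `m` arrows. -/
def IsCycle (M : ℕ) (y : ℤ → ℤ) (m : ℕ) (c : ℕ → ℤ) : Prop :=
  c m = c 0 ∧ ∀ j < m, 0 ≤ c j ∧ c j < M ∧ Arrow y (c j) (c (j + 1))

/-- The product of the increments along a chain; its sign is the orientation of the chain. -/
def orient (y : ℤ → ℤ) (m : ℕ) (c : ℕ → ℤ) : ℤ :=
  ∏ j ∈ Finset.range m, (y (c j + 1) - y (c j))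

lemma exists_backward_chain (g : ℕ → ℤ → ℤ) (d : ℕ → ℤ) (m : ℕ)
    (hg : ∀ j < m, ∀ s t, s ≤ t → 0 ≤ d j * (g j t - g j s)) :
    ∃ T : ℤ → ℕ → ℤ, (∀ s, T s m = s) ∧ (∀ s, ∀ j < m, T s j = g j (T s (j + 1))) ∧
      ∀ s t, s ≤ t → 0 ≤ (∏ j ∈ Finset.range m, d j) * (T t 0 - T s 0) := by
  induction m with
  | zero => exact ⟨fun s _ => s, fun _ => rfl, by simp, fun s t h => by simpa using h⟩
  | succ m ih =>
    obtain ⟨T, h1, h2, h3⟩ := ih fun j hj => hg j (by omega)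
    refine ⟨fun s j => if j ≤ m then T (g m s) j else s, by simp, fun s j hj => ?_, ?_⟩
    · rcases (Nat.lt_succ_iff.1 hj).lt_or_eq with h' | rfl
      · have e1 : j ≤ m := h'.le
        have e2 : j + 1 ≤ m := h'
        simp only [e1, e2, if_true]
        exact h2 _ j h'
      · simp [h1]
    · intro s t hst
      simp only [zero_le, if_true]
      rw [Finset.prod_range_succ]
      have hm := hg m (by omega) s t hst
      rcases lt_trichotomy (d m) 0 with hd | hd | hd
      · have := h3 (g m t) (g m s) (by nlinarith)
        nlinarith
      · simp [hd]
      · have := h3 (g m s) (g m t) (by nlinarith)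
        nlinarith

/-- Which half of a lap with middle value `w` and direction `d` covers the value `b`. -/
def half (w d b : ℤ) : ℤ := if (b < w ↔ 0 < d) then 0 else 1

lemma half_eq (w d b : ℤ) : half w d b = 0 ∨ half w d b = 1 := by
  unfold half; split_ifs <;> simp

lemma half_mono (w d b b' : ℤ) (h : b ≤ b') : 0 ≤ d * (half w d b' - half w d b) := by
  unfold half
  rcases lt_or_ge 0 d with hd | hd
  · simp only [hd, iff_true]
    split_ifs with h1 h2 h2 <;> omega
  · simp only [hd.not_gt, iff_false, not_lt]
    split_ifs with h1 h2 h2 <;> omega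

lemma arrow_lap {y : ℤ → ℤ} {i b l e : ℤ} (hl : l = 0 ∧ e = 1 ∨ l = 2 ∧ e = 1 ∨ l = 1 ∧ e = -1)
    (ha : Arrow y i (b / 6)) :
    Arrow (refineNodes y)
      (6 * i + (2 * l + half (3 * y i + 3 * y (i + 1)) (e * (y (i + 1) - y i)) b)) b ∧
    refineNodes y
      (6 * i + (2 * l + half (3 * y i + 3 * y (i + 1)) (e * (y (i + 1) - y i)) b) + 1) -
      refineNodes y (6 * i + (2 * l + half (3 * y i + 3 * y (i + 1)) (e * (y (i + 1) - y i)) b)) =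
      3 * (e * (y (i + 1) - y i)) := by
  obtain ⟨v0, v1, v2, v3, v4, v5, v6⟩ := refineNodes_values y i
  obtain ⟨ha, hb⟩ := ha
  unfold half Arrow
  rcases hl with ⟨rfl, rfl⟩ | ⟨rfl, rfl⟩ | ⟨rfl, rfl⟩ <;> split_ifs with h <;>
    simp only [add_assoc] <;> norm_num <;> simp only [v0, v1, v2, v3, v4, v5, v6] <;> omega

/-- A cycle lifts to the refined grid, with a prescribed lap of the right orientation. -/
lemma IsCycle.lift {M : ℕ} {y : ℤ → ℤ} {m : ℕ} {c : ℕ → ℤ} (hc : IsCycle M y m c) (hm : 0 < m)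
    {l e : ℤ} (hl : l = 0 ∧ e = 1 ∨ l = 2 ∧ e = 1 ∨ l = 1 ∧ e = -1) (ho : 0 < e * orient y m c) :
    ∃ c', IsCycle (6 * M) (refineNodes y) m c' ∧ (∀ j ≤ m, c' j / 6 = c j) ∧
      (c' 0 = 6 * c 0 + 2 * l ∨ c' 0 = 6 * c 0 + 2 * l + 1) ∧ 0 < orient (refineNodes y) m c' := by
  let L : ℕ → ℤ := fun j => if j = 0 then l else 0
  let E : ℕ → ℤ := fun j => if j = 0 then e else 1
  have hLE : ∀ j, L j = 0 ∧ E j = 1 ∨ L j = 2 ∧ E j = 1 ∨ L j = 1 ∧ E j = -1 := by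
    intro j
    by_cases hj : j = 0 <;> simp [L, E, hj, hl]
  let d : ℕ → ℤ := fun j => E j * (y (c j + 1) - y (c j))
  let g : ℕ → ℤ → ℤ := fun j t =>
    2 * L j + half (3 * y (c j) + 3 * y (c j + 1)) (d j) (6 * c (j + 1) + t)
  have hprod : ∏ j ∈ Finset.range m, d j = e * orient y m c := by
    simp only [d, Finset.prod_mul_distrib, orient]
    congr 1
    simp [E, Finset.prod_ite_eq', hm]
  obtain ⟨T, h1, h2, h3⟩ := exists_backward_chain g d m (fun j _ s t hst => by
    have := half_mono (3 * y (c j) + 3 * y (c j + 1)) (d j) (6 * c (j + 1) + s)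
      (6 * c (j + 1) + t) (by omega)
    simpa [g] using this)
  have hmono : ∀ s t, s ≤ t → T s 0 ≤ T t 0 := fun s t hst => by
    have := h3 s t hst
    rw [hprod] at this
    nlinarith
  have hrange : ∀ s, ∀ j < m, T s j = 2 * L j ∨ T s j = 2 * L j + 1 := by
    intro s j hj
    rw [h2 s j hj]
    rcases half_eq (3 * y (c j) + 3 * y (c j + 1)) (d j) (6 * c (j + 1) + T s (j + 1)) with h | h
    · left; simp only [g, h, add_zero]
    · right; simp only [g, h]
  obtain ⟨s, hs⟩ : ∃ s, T s 0 = s := by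
    have a1 := hrange (2 * L 0) 0 hm
    have a2 := hrange (2 * L 0 + 1) 0 hm
    have a3 := hmono (2 * L 0) (2 * L 0 + 1) (by omega)
    rcases a1 with a1 | a1
    · exact ⟨_, a1⟩
    · exact ⟨2 * L 0 + 1, by omega⟩
  have hT : ∀ j ≤ m, 0 ≤ T s j ∧ T s j < 6 := by
    have aux : ∀ j < m, 0 ≤ T s j ∧ T s j < 6 := by
      intro j hj
      have := hrange s j hj
      have := hLE j
      omega
    intro j hj
    rcases hj.lt_or_eq with hj | rfl
    · exact aux j hj
    · rw [h1 s]
      have := aux 0 hm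
      rwa [hs] at this
  have hlap : ∀ j < m, _ := fun j hj => arrow_lap (y := y) (i := c j) (b := 6 * c (j + 1) +
    T s (j + 1)) (hLE j) (by
      have e1 : (6 * c (j + 1) + T s (j + 1)) / 6 = c (j + 1) := by
        have := hT (j + 1) hj
        omega
      rw [e1]
      exact (hc.2 j hj).2.2)
  refine ⟨fun j => 6 * c j + T s j, ⟨?_, fun j hj => ⟨?_, ?_, ?_⟩⟩, fun j hj => ?_, ?_, ?_⟩
  · simp only [h1 s, hs, hc.1]
  · have := hT j hj.le
    have := hc.2 j hj
    simp only; omega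
  · have := hT j hj.le
    have := hc.2 j hj
    push_cast; omega
  · have := (hlap j hj).1
    simp only
    rw [h2 s j hj]
    exact this
  · have := hT j hj
    simp only; omega
  · have := hrange s 0 hm
    simp only [L, if_true] at this
    show 6 * c 0 + T s 0 = 6 * c 0 + 2 * l ∨ 6 * c 0 + T s 0 = 6 * c 0 + 2 * l + 1
    omega
  · rw [orient]
    have : ∀ j ∈ Finset.range m, (refineNodes y (6 * c j + T s j + 1) -
        refineNodes y (6 * c j + T s j)) = 3 * d j := by
      intro j hj
      rw [h2 s j (Finset.mem_range.1 hj)]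
      exact (hlap j (Finset.mem_range.1 hj)).2
    rw [Finset.prod_congr rfl this, Finset.prod_mul_distrib, hprod]
    exact mul_pos (Finset.prod_pos fun _ _ => by norm_num) ho

lemma cell_refine_subset {M : ℕ} (hM : 0 < M) {a i : ℤ} (h : a / 6 = i) :
    cell (6 * M) a ⊆ cell M i := by
  have hM' : (0 : ℝ) < M := by exact_mod_cast hM
  have h1 : (6 * i : ℝ) ≤ a := by exact_mod_cast (by omega : 6 * i ≤ a)
  have h2 : (a : ℝ) + 1 ≤ 6 * (i + 1) := by exact_mod_cast (by omega : a + 1 ≤ 6 * (i + 1))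
  refine Icc_subset_Icc ?_ ?_
  · push_cast
    rw [div_le_div_iff₀ hM' (by positivity)]
    nlinarith
  · push_cast
    rw [div_le_div_iff₀ (by positivity) hM']
    nlinarith

/-- A positively oriented cycle lifts so that the first cell avoids a given point. -/
lemma IsCycle.lift_avoiding {M : ℕ} (hM : 0 < M) {y : ℤ → ℤ} {m : ℕ} {c : ℕ → ℤ}
    (hc : IsCycle M y m c) (hm : 0 < m) (ho : 0 < orient y m c) (z : ℝ) :
    ∃ c', IsCycle (6 * M) (refineNodes y) m c' ∧ 0 < orient (refineNodes y) m c' ∧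
      (∀ j ≤ m, c' j / 6 = c j) ∧ z ∉ cell (6 * M) (c' 0) := by
  have hM' : (0 : ℝ) < (6 * M : ℕ) := by exact_mod_cast (by omega : 0 < 6 * M)
  obtain ⟨c₁, a1, a2, a3, a4⟩ := hc.lift hm (l := 0) (e := 1) (by simp) (by simpa using ho)
  obtain ⟨c₂, b1, b2, b3, b4⟩ := hc.lift hm (l := 2) (e := 1) (by simp) (by simpa using ho)
  by_cases hz : z ∈ cell (6 * M) (c₁ 0)
  · refine ⟨c₂, b1, b4, b2, fun hz' => ?_⟩
    have h1 := hz.2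
    have h2 := hz'.1
    have h3 : (c₁ 0 : ℝ) + 1 < c₂ 0 := by exact_mod_cast (by omega : c₁ 0 + 1 < c₂ 0)
    have h4 := (div_lt_div_iff_of_pos_right hM').2 h3
    linarith
  · exact ⟨c₁, a1, a4, a2, hz⟩

/-- The points following a cycle periodically. -/
def followers (G : ℝ → ℝ) (M m : ℕ) (c : ℕ → ℤ) : Set ℝ :=
  {x | G^[m] x = x ∧ ∀ j < m, G^[j] x ∈ cell M (c j)}

lemma IsCycle.exists_follower {M : ℕ} {y : ℤ → ℤ} (h : IsNodes M y) {m : ℕ} {c : ℕ → ℤ}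
    (hc : IsCycle M y m c) (hm : 0 < m) (ho : 0 < orient y m c) (z : ℕ → ℝ) :
    ∃ x ∈ followers (gridMap M y) M m c, ∀ n, x ≠ z n := by
  let P : ℕ → (ℕ → ℤ) → Prop := fun n c =>
    IsCycle (6 ^ n * M) (refineNodes^[n] y) m c ∧ 0 < orient (refineNodes^[n] y) m c
  have hstep : ∀ n (c : {c // P n c}), ∃ c' : {c // P (n + 1) c},
      (∀ j ≤ m, c'.1 j / 6 = c.1 j) ∧ z n ∉ cell (6 ^ (n + 1) * M) (c'.1 0) := by
    rintro n ⟨c, hc1, hc2⟩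
    obtain ⟨c', a1, a2, a3, a4⟩ := hc1.lift_avoiding (iterate_refine h n).1.1 hm hc2 (z n)
    rw [← mul_assoc, ← pow_succ'] at a1 a4
    exact ⟨⟨c', by simpa only [P, Function.iterate_succ_apply'] using ⟨a1, a2⟩⟩, a3, a4⟩
  choose next hnext using hstep
  let C : ∀ n, {c // P n c} :=
    fun n => Nat.rec (motive := fun n => {c // P n c}) ⟨c, by simpa [P] using ⟨hc, ho⟩⟩ next n
  have hC : ∀ n, (∀ j ≤ m, (C (n + 1)).1 j / 6 = (C n).1 j) ∧
      z n ∉ cell (6 ^ (n + 1) * M) ((C (n + 1)).1 0) := fun n => hnext n (C n)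
  have hpos : ∀ n, 0 < 6 ^ n * M := fun n => (iterate_refine h n).1.1
  have hne : ∀ j ≤ m, (⋂ n, cell (6 ^ n * M) ((C n).1 j)).Nonempty := by
    intro j hj
    refine IsCompact.nonempty_iInter_of_sequence_nonempty_isCompact_isClosed _ (fun n => ?_)
      (fun n => ?_) isCompact_Icc fun n => isClosed_Icc
    · rw [pow_succ', mul_assoc]
      exact cell_refine_subset (hpos n) ((hC n).1 j hj)
    · refine nonempty_Icc.2 ?_
      gcongr
      linarith
  have hlim : Tendsto (fun n : ℕ => 1 / ((6 ^ n * M : ℕ) : ℝ)) atTop (𝓝 0) := by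
    have hM' : (0 : ℝ) < M := by exact_mod_cast h.1
    have : Tendsto (fun n : ℕ => (1 / 6 : ℝ) ^ n * (1 / M)) atTop (𝓝 (0 * (1 / M))) :=
      (tendsto_pow_atTop_nhds_zero_of_lt_one (by norm_num) (by norm_num)).mul_const _
    rw [zero_mul] at this
    refine this.congr fun n => ?_
    push_cast
    rw [one_div_pow, one_div_mul_one_div]
  have hdist : ∀ n (i : ℤ) x x', x ∈ cell (6 ^ n * M) i → x' ∈ cell (6 ^ n * M) i →
      |x - x'| ≤ 1 / ((6 ^ n * M : ℕ) : ℝ) := by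
    rintro n i x x' ⟨a1, a2⟩ ⟨b1, b2⟩
    rw [add_div] at a2 b2
    rw [abs_le]
    constructor <;> linarith
  have huniq : ∀ j x x', x ∈ (⋂ n, cell (6 ^ n * M) ((C n).1 j)) →
      x' ∈ (⋂ n, cell (6 ^ n * M) ((C n).1 j)) → x = x' := by
    intro j x x' hx hx'
    rw [mem_iInter] at hx hx'
    have : |x - x'| ≤ 0 := ge_of_tendsto' hlim fun n => hdist n _ _ _ (hx n) (hx' n)
    exact sub_eq_zero.1 (abs_nonpos_iff.1 this)
  have hmap : ∀ j < m, ∀ x ∈ (⋂ n, cell (6 ^ n * M) ((C n).1 j)),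
      gridMap M y x ∈ ⋂ n, cell (6 ^ n * M) ((C n).1 (j + 1)) := by
    intro j hj x hx
    obtain ⟨x', hx'⟩ := hne (j + 1) hj
    suffices hh : gridMap M y x = x' by rwa [hh]
    have hw : ∀ n, ∃ w ∈ cell (6 ^ n * M) ((C n).1 j), gridMap M y w = x' := by
      intro n
      obtain ⟨b0, b1, b2⟩ := (C n).2.1.2 j hj
      have := cell_subset_image (hpos n) _ b0 b1 b2 (mem_iInter.1 hx' n)
      rwa [(iterate_refine h n).2] at this
    choose w hw1 hw2 using hw
    have hwx : Tendsto w atTop (𝓝 x) := by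
      rw [tendsto_iff_dist_tendsto_zero]
      exact squeeze_zero (fun _ => dist_nonneg)
        (fun n => hdist n _ _ _ (hw1 n) (mem_iInter.1 hx n)) hlim
    have h1 := ((continuous_gridMap M y).tendsto x).comp hwx
    refine tendsto_nhds_unique h1 ?_
    simp [Function.comp_def, hw2]
  obtain ⟨x, hx⟩ := hne 0 (Nat.zero_le m)
  have hiter : ∀ j ≤ m, (gridMap M y)^[j] x ∈ ⋂ n, cell (6 ^ n * M) ((C n).1 j) := by
    intro j
    induction j with
    | zero => exact fun _ => hx
    | succ j ih =>
      intro hj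
      rw [Function.iterate_succ_apply']
      exact hmap j hj _ (ih (by omega))
  refine ⟨x, ⟨huniq 0 _ _ ?_ hx, fun j hj => ?_⟩, fun n hn => (hC n).2 ?_⟩
  · have := hiter m le_rfl
    simpa only [fun n => (C n).2.1.1] using this
  · have := mem_iInter.1 (hiter j hj.le) 0
    simpa [C] using this
  · rw [← hn]
    exact mem_iInter.1 hx (n + 1)

/-- Uncountably many points follow a given cycle periodically. -/
lemma IsCycle.not_countable_followers {M : ℕ} {y : ℤ → ℤ} (h : IsNodes M y) {m : ℕ} {c : ℕ → ℤ}
    (hc : IsCycle M y m c) (hm : 0 < m) : ¬ (followers (gridMap M y) M m c).Countable := by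
  intro hcount
  obtain ⟨z, hz⟩ := Set.countable_iff_exists_subset_range.1 hcount
  have ho : orient y m c ≠ 0 := Finset.prod_ne_zero_iff.2 fun j hj => by
    obtain ⟨b0, b1, -⟩ := hc.2 j (Finset.mem_range.1 hj)
    exact sub_ne_zero.2 (h.2.2 _ b0 b1).symm
  obtain ⟨x, hx, hxz⟩ : ∃ x ∈ followers (gridMap M y) M m c, ∀ n, x ≠ z n := by
    rcases ho.lt_or_gt with ho | ho
    · obtain ⟨c', a1, a2, -, a4⟩ := hc.lift hm (l := 1) (e := -1) (by simp) (by simpa using ho)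
      obtain ⟨x, ⟨hx1, hx2⟩, hx3⟩ := a1.exists_follower h.refine hm a4 z
      rw [gridMap_refine] at hx1 hx2
      exact ⟨x, ⟨hx1, fun j hj => cell_refine_subset h.1 (a2 j hj.le) (hx2 j hj)⟩, hx3⟩
    · exact hc.exists_follower h hm ho z
  obtain ⟨n, hn⟩ := hz hx
  exact hxz n hn.symm


/-- An atomless invariant probability measure carried by the periodic points of `g`. -/
structure PeriodicMeasure (g : unitInterval → unitInterval) (μ : Measure unitInterval) : Prop where
  mass_univ : μ univ = 1
  mass_singleton : ∀ x, μ {x} = 0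
  preimage : ∀ A, MeasurableSet A → μ (g ⁻¹' A) = μ A
  compl_perAll : μ (PerAll g)ᶜ = 0

lemma measurableSet_fixSet {g : unitInterval → unitInterval} (hg : Continuous g) (k : ℕ) :
    MeasurableSet (FixSet g k) :=
  (isClosed_eq (hg.iterate k) continuous_id).measurableSet

lemma measurableSet_perAll {g : unitInterval → unitInterval} (hg : Continuous g) :
    MeasurableSet (PerAll g) :=
  MeasurableSet.biUnion (Set.to_countable _) fun k _ => measurableSet_fixSet hg k

/-- An uncountable closed set carries an atomless probability measure. -/
lemma exists_atomless_measure {X : Set unitInterval} (hX : IsClosed X) (hu : ¬ X.Countable) :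
    ∃ ν : Measure unitInterval, ν univ = 1 ∧ (∀ x, ν {x} = 0) ∧ ν Xᶜ = 0 := by
  have h1 : ¬ Countable X := fun h => hu h
  have h2 : ¬ Countable unitInterval := fun h =>
    hu ((Set.countable_univ (α := unitInterval)).mono (subset_univ X))
  have : PolishSpace X := hX.polishSpace
  let e : unitInterval ≃ᵐ X := PolishSpace.measurableEquivOfNotCountable h2 h1
  have hm : Measurable (fun t => (e t : unitInterval)) := measurable_subtype_coe.comp e.measurable
  refine ⟨(volume : Measure unitInterval).map fun t => (e t : unitInterval), ?_, fun x => ?_, ?_⟩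
  · rw [Measure.map_apply hm MeasurableSet.univ]
    simp
  · rw [Measure.map_apply hm (measurableSet_singleton x)]
    refine Set.Subsingleton.measure_zero (fun s hs t ht => ?_) _
    refine e.injective (Subtype.ext ?_)
    rw [mem_preimage, mem_singleton_iff] at hs ht
    rw [hs, ht]
  · rw [Measure.map_apply hm hX.measurableSet.compl]
    convert measure_empty (μ := (volume : Measure unitInterval))
    ext t
    simp

/-- The average of the first `m` push-forwards of `ν`. -/
def orbitAverage (g : unitInterval → unitInterval) (m : ℕ) (ν : Measure unitInterval) :
    Measure unitInterval :=
  (m : ENNReal)⁻¹ • ∑ j ∈ Finset.range m, ν.map g^[j]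

lemma orbitAverage_apply {g : unitInterval → unitInterval} (hg : Continuous g) (m : ℕ)
    (ν : Measure unitInterval) {A : Set unitInterval} (hA : MeasurableSet A) :
    orbitAverage g m ν A = (m : ENNReal)⁻¹ * ∑ j ∈ Finset.range m, ν (g^[j] ⁻¹' A) := by
  simp only [orbitAverage, Measure.smul_apply, Measure.finsetSum_apply, smul_eq_mul]
  congr 1
  exact Finset.sum_congr rfl fun j _ => Measure.map_apply (hg.iterate j).measurable hA

lemma measure_congr_of_compl_null {ν : Measure unitInterval} {X A B : Set unitInterval}
    (hX : ν Xᶜ = 0) (h : ∀ x ∈ X, x ∈ A → x ∈ B) : ν A ≤ ν B := by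
  calc ν A ≤ ν (B ∪ Xᶜ) := measure_mono fun x hx => by
        by_cases hxX : x ∈ X
        · exact Or.inl (h x hxX hx)
        · exact Or.inr hxX
    _ ≤ ν B + ν Xᶜ := measure_union_le _ _
    _ = ν B := by rw [hX, add_zero]

lemma periodicMeasure_orbitAverage {g : unitInterval → unitInterval} (hg : Continuous g) {m : ℕ}
    (hm : 0 < m) {X : Set unitInterval} (hX : X ⊆ FixSet g m) {ν : Measure unitInterval}
    (h1 : ν univ = 1) (h2 : ∀ x, ν {x} = 0) (h3 : ν Xᶜ = 0) :
    PeriodicMeasure g (orbitAverage g m ν) := by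
  have hm0 : (m : ENNReal) ≠ 0 := by exact_mod_cast hm.ne'
  refine ⟨?_, fun x => ?_, fun A hA => ?_, ?_⟩
  · rw [orbitAverage_apply hg m ν MeasurableSet.univ]
    simp only [preimage_univ, h1, Finset.sum_const, Finset.card_range, nsmul_eq_mul, mul_one]
    exact ENNReal.inv_mul_cancel hm0 (ENNReal.natCast_ne_top m)
  · rw [orbitAverage_apply hg m ν (measurableSet_singleton x)]
    rw [Finset.sum_eq_zero, mul_zero]
    intro j hj
    have hj := Finset.mem_range.1 hj
    refine le_antisymm ?_ (zero_le)
    rw [← h2 (g^[m - j] x)]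
    refine measure_congr_of_compl_null h3 fun z hz hzx => ?_
    rw [mem_preimage, mem_singleton_iff] at hzx
    rw [mem_singleton_iff, ← hzx, ← Function.iterate_add_apply, Nat.sub_add_cancel hj.le]
    exact (hX hz).symm
  · rw [orbitAverage_apply hg m ν (hg.measurable hA), orbitAverage_apply hg m ν hA]
    congr 1
    have e : ∀ j, ν (g^[j] ⁻¹' (g ⁻¹' A)) = ν (g^[j + 1] ⁻¹' A) := fun j => by
      rw [Function.iterate_succ', preimage_comp]
    simp only [e]
    obtain ⟨n, rfl⟩ := Nat.exists_eq_succ_of_ne_zero hm.ne'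
    rw [Finset.sum_range_succ, Finset.sum_range_succ' (fun j => ν (g^[j] ⁻¹' A))]
    congr 1
    refine le_antisymm (measure_congr_of_compl_null h3 fun z hz hzA => ?_)
      (measure_congr_of_compl_null h3 fun z hz hzA => ?_)
    · rw [mem_preimage, hX hz] at hzA
      exact hzA
    · rw [mem_preimage, hX hz]
      exact hzA
  · rw [orbitAverage_apply hg m ν (measurableSet_perAll hg).compl, Finset.sum_eq_zero, mul_zero]
    intro j hj
    refine le_antisymm ?_ (zero_le)
    rw [← measure_empty (μ := ν)]
    refine measure_congr_of_compl_null h3 fun z hz hzx => hzx ?_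
    refine mem_biUnion (x := m) (show 1 ≤ m from hm) ?_
    show g^[m] (g^[j] z) = g^[j] z
    rw [← Function.iterate_add_apply, add_comm, Function.iterate_add_apply, hX hz]

/-- An uncountable closed set of points of a common period has positive measure for some
periodic measure. -/
lemma exists_periodicMeasure_pos {g : unitInterval → unitInterval} (hg : Continuous g) {m : ℕ}
    (hm : 0 < m) {X : Set unitInterval} (hX : X ⊆ FixSet g m) (hc : IsClosed X)
    (hu : ¬ X.Countable) : ∃ μ, PeriodicMeasure g μ ∧ 0 < μ X := by
  obtain ⟨ν, h1, h2, h3⟩ := exists_atomless_measure hc hu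
  refine ⟨_, periodicMeasure_orbitAverage hg hm hX h1 h2 h3, ?_⟩
  rw [orbitAverage_apply hg m ν hc.measurableSet]
  refine ENNReal.mul_pos (ENNReal.inv_ne_zero.2 (ENNReal.natCast_ne_top m)) ?_
  have : ν X = 1 := by
    refine le_antisymm (h1 ▸ measure_mono (subset_univ X)) ?_
    rw [← h1]
    exact measure_congr_of_compl_null h3 fun x hx _ => hx
  intro h
  have := (Finset.sum_eq_zero_iff.1 h) 0 (Finset.mem_range.2 hm)
  simp_all

lemma PeriodicMeasure.sum {ι : Type*} [Countable ι] {g : unitInterval → unitInterval}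
    (hg : Continuous g) {w : ι → ENNReal} (hw : ∑' i, w i = 1) {ρ : ι → Measure unitInterval}
    (h : ∀ i, PeriodicMeasure g (ρ i)) :
    PeriodicMeasure g (Measure.sum fun i => w i • ρ i) := by
  refine ⟨?_, fun x => ?_, fun A hA => ?_, ?_⟩
  · rw [Measure.sum_apply _ MeasurableSet.univ]
    simpa [(h _).mass_univ] using hw
  · rw [Measure.sum_apply _ (measurableSet_singleton x)]
    simp [(h _).mass_singleton]
  · rw [Measure.sum_apply _ (hg.measurable hA), Measure.sum_apply _ hA]
    simp [(h _).preimage A hA]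
  · rw [Measure.sum_apply _ (measurableSet_perAll hg).compl]
    simp [(h _).compl_perAll]

lemma PeriodicMeasure.add {g : unitInterval → unitInterval} {a b : ENNReal} (hab : a + b = 1)
    {μ ν : Measure unitInterval} (hμ : PeriodicMeasure g μ) (hν : PeriodicMeasure g ν) :
    PeriodicMeasure g (a • μ + b • ν) := by
  refine ⟨?_, fun x => ?_, fun A hA => ?_, ?_⟩ <;> simp only [Measure.add_apply,
    Measure.smul_apply, smul_eq_mul]
  · rw [hμ.mass_univ, hν.mass_univ, mul_one, mul_one, hab]
  · rw [hμ.mass_singleton, hν.mass_singleton, mul_zero, mul_zero, add_zero]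
  · rw [hμ.preimage A hA, hν.preimage A hA]
  · rw [hμ.compl_perAll, hν.compl_perAll, mul_zero, mul_zero, add_zero]

/-- Countably many sets that are charged by periodic measures are charged by a single one. -/
lemma exists_periodicMeasure_pos_of_countable {ι : Type*} [Countable ι] [Nonempty ι]
    {g : unitInterval → unitInterval} (hg : Continuous g) {X : ι → Set unitInterval}
    (h : ∀ i, ∃ μ, PeriodicMeasure g μ ∧ 0 < μ (X i)) :
    ∃ μ, PeriodicMeasure g μ ∧ ∀ i, 0 < μ (X i) := by
  choose ρ hρ hpos using h
  obtain ⟨s, hs⟩ := exists_surjective_nat ι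
  let w : ℕ → ENNReal := fun n => 2⁻¹ ^ (n + 1)
  have hw : ∑' n, w n = 1 := by
    rw [ENNReal.tsum_geometric_add_one, ENNReal.one_sub_inv_two, inv_inv]
    exact ENNReal.inv_mul_cancel (by simp) (by simp)
  refine ⟨_, PeriodicMeasure.sum hg hw fun n => hρ (s n), fun i => ?_⟩
  obtain ⟨n, rfl⟩ := hs i
  refine lt_of_lt_of_le ?_ (Measure.le_sum_apply _ _)
  refine lt_of_lt_of_le ?_ (ENNReal.le_tsum n)
  exact ENNReal.mul_pos (pow_ne_zero _ (by simp)) (hpos _).ne'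

lemma perAll_eq_iUnion_perSet {X : Type*} (f : X → X) :
    PerAll f = ⋃ k ∈ {k : ℕ | 1 ≤ k}, PerSet f k := by
  classical
  refine Subset.antisymm (fun x hx => ?_) (iUnion₂_mono fun k _ x hx => hx.1)
  simp only [PerAll, mem_iUnion] at hx
  obtain ⟨k, hk, hx⟩ := hx
  have h : ∃ k, 1 ≤ k ∧ f^[k] x = x := ⟨k, hk, hx⟩
  refine mem_biUnion (x := Nat.find h) (Nat.find_spec h).1 ⟨(Nat.find_spec h).2, ?_⟩
  intro i h1 h2 h3
  exact Nat.find_min h h2 ⟨h1, h3⟩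

/-- The distribution function of an atomless probability measure of full support is a
homeomorphism that transports the measure to Lebesgue measure. -/
lemma exists_homeomorph_map_eq_lebI {μ : Measure unitInterval} (h1 : μ univ = 1)
    (h2 : ∀ x, μ {x} = 0) (h3 : ∀ U, IsOpen U → U.Nonempty → 0 < μ U) :
    ∃ h : unitInterval ≃ₜ unitInterval, (∀ x, (h x : ℝ) = (μ (Iic x)).toReal) ∧
      ∀ A, lebI A = μ (h ⁻¹' A) := by
  have : IsProbabilityMeasure μ := ⟨h1⟩
  let F : unitInterval → unitInterval := fun x =>
    ⟨(μ (Iic x)).toReal, ENNReal.toReal_nonneg, measureReal_le_one⟩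
  have hmono : StrictMono F := by
    intro x y hxy
    show (μ (Iic x)).toReal < (μ (Iic y)).toReal
    rw [ENNReal.toReal_lt_toReal (measure_ne_top _ _) (measure_ne_top _ _)]
    have hd : Disjoint (Iic x) (Ioo x y) := by
      rw [Set.disjoint_left]
      exact fun z hz hz' => hz'.1.not_ge hz
    have hle : μ (Iic x) + μ (Ioo x y) ≤ μ (Iic y) := by
      rw [← measure_union hd measurableSet_Ioo]
      refine measure_mono (union_subset (Iic_subset_Iic.2 hxy.le) fun z hz => hz.2.le)
    refine lt_of_lt_of_le ?_ hle
    exact ENNReal.lt_add_right (measure_ne_top _ _)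
      (h3 _ isOpen_Ioo (nonempty_Ioo.2 hxy)).ne'
  have hcont : Continuous F := by
    refine Continuous.subtype_mk (continuous_iff_continuousAt.2 fun x => ?_) _
    refine (ENNReal.tendsto_toReal (measure_ne_top μ _)).comp ?_
    refine tendsto_measure_of_ae_tendsto_indicator_of_isFiniteMeasure (𝓝 x) measurableSet_Iic
      (fun _ => measurableSet_Iic) ?_
    have hae : ∀ᵐ z ∂μ, z ≠ x := by
      rw [ae_iff]
      simpa using h2 x
    filter_upwards [hae] with z hz
    rcases lt_or_gt_of_ne hz with hz | hz
    · filter_upwards [Ioi_mem_nhds hz] with i hi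
      exact ⟨fun _ => hz.le, fun _ => mem_Iic.2 (le_of_lt hi)⟩
    · filter_upwards [Iio_mem_nhds hz] with i hi
      exact ⟨fun h => absurd (lt_of_lt_of_le (mem_Iio.1 hi) (mem_Iic.1 h)) (lt_irrefl _),
        fun h => absurd (lt_of_lt_of_le hz (mem_Iic.1 h)) (lt_irrefl _)⟩
  have hF0 : F 0 = 0 := by
    refine Subtype.ext ?_
    show (μ (Iic 0)).toReal = 0
    have : (Iic (0 : unitInterval)) = {0} := by
      ext z
      simp
    rw [this, h2]
    rfl
  have hF1 : F 1 = 1 := by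
    refine Subtype.ext ?_
    show (μ (Iic 1)).toReal = 1
    have : (Iic (1 : unitInterval)) = univ := by
      ext z
      simpa using unitInterval.le_one'
    rw [this, h1]
    rfl
  have hsurj : Function.Surjective F := by
    intro t
    have := intermediate_value_univ (0 : unitInterval) 1 hcont
    rw [hF0, hF1] at this
    exact this ⟨unitInterval.nonneg', unitInterval.le_one'⟩
  let h : unitInterval ≃ₜ unitInterval := (hmono.orderIsoOfSurjective F hsurj).toHomeomorph
  have hh : ∀ x, h x = F x := fun _ => rfl
  refine ⟨h, fun x => rfl, fun A => ?_⟩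
  have e0 : μ (h ⁻¹' A) = μ.map h.toMeasurableEquiv A :=
    (h.toMeasurableEquiv.map_apply A).symm
  rw [e0]
  congr 1
  have : IsFiniteMeasure (μ.map h.toMeasurableEquiv) := inferInstance
  refine (Measure.ext_of_Iic _ _ fun a => ?_).symm
  obtain ⟨x, rfl⟩ := hsurj a
  rw [h.toMeasurableEquiv.map_apply]
  have e : h.toMeasurableEquiv ⁻¹' Iic (F x) = Iic x := by
    ext z
    show F z ≤ F x ↔ z ≤ x
    exact hmono.le_iff_le
  rw [e]
  have : lebI (Iic (F x)) = ENNReal.ofReal (F x) := unitInterval.volume_Iic (F x)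
  rw [this]
  exact (ENNReal.ofReal_toReal (measure_ne_top μ _)).symm

/-- A locally eventually onto map with a suitable periodic measure is conjugate to a
Lebesgue-measure-preserving map with the desired properties. -/
lemma PeriodicMeasure.exists_conjugate {g : C(unitInterval, unitInterval)}
    {μ : Measure unitInterval} (hμ : PeriodicMeasure g μ)
    (hpos : ∀ U, IsOpen U → U.Nonempty → 0 < μ U) 
    (hleo : ∀ J, IsOpen J → J.Nonempty → ∃ n : ℕ, g^[n] '' J = Set.univ)
    (hper : ∀ k, 1 ≤ k → 0 < μ (PerSet g k)) :
    ∃ f ∈ CLam, (Leo f ∧ lebI (⋃ k ∈ {k : ℕ | 1 ≤ k}, PerSet f k) = 1 ∧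
      ∀ k : ℕ, 1 ≤ k → 0 < lebI (PerSet f k)) ∧
      ∃ h : unitInterval ≃ₜ unitInterval, (∀ x, (h x : ℝ) = (μ (Iic x)).toReal) ∧
        ∀ x, f (h x) = h (g x) := by
  obtain ⟨h, hh, hleb⟩ := exists_homeomorph_map_eq_lebI hμ.mass_univ hμ.mass_singleton hpos
  let f : C(unitInterval, unitInterval) := ⟨fun x => h (g (h.symm x)), by fun_prop⟩
  have hf : ∀ x, f (h x) = h (g x) := fun x => by simp [f]
  have hit : ∀ n x, f^[n] (h x) = h (g^[n] x) := by
    intro n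
    induction n with
    | zero => intro x; rfl
    | succ n ih =>
      intro x
      rw [Function.iterate_succ_apply, hf, ih, Function.iterate_succ_apply]
  have hset : ∀ k, h ⁻¹' PerSet f k = PerSet g k := by
    intro k
    ext x
    simp [PerSet, hit]
  refine ⟨f, ?_, ⟨?_, ?_, ?_⟩, h, hh, hf⟩
  · intro A hA
    rw [hleb, hleb, ← hμ.preimage _ (h.continuous.measurable hA)]
    congr 1
    ext x
    simp [hf]
  · intro J hJ hJo hJn
    obtain ⟨n, hn⟩ := hleo (h ⁻¹' J) (hJo.preimage h.continuous) (hJn.preimage h.surjective)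
    refine ⟨n, eq_univ_of_forall fun y => ?_⟩
    obtain ⟨x, hx, hxy⟩ := hn.symm.subset (mem_univ (h.symm y))
    exact ⟨h x, hx, by rw [hit, hxy, h.apply_symm_apply]⟩
  · rw [hleb]
    simp only [preimage_iUnion, hset]
    rw [← perAll_eq_iUnion_perSet, ← hμ.mass_univ]
    refine le_antisymm (measure_mono (subset_univ _)) ?_
    calc μ univ ≤ μ (PerAll g) + μ (PerAll g)ᶜ := measure_univ_le_add_compl _
      _ = μ (PerAll g) := by rw [hμ.compl_perAll, add_zero]
  · intro k hk
    rw [hleb, hset]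
    exact hper k hk

/-- The self-map of the unit interval given by an admissible node sequence. -/
def gridSelf {M : ℕ} {y : ℤ → ℤ} (h : IsNodes M y) : C(unitInterval, unitInterval) :=
  ⟨fun x => ⟨gridMap M y x, gridMap_mem_unit h x.2⟩,
    ((continuous_gridMap M y).comp continuous_subtype_val).subtype_mk _⟩

lemma coe_iterate_gridSelf {M : ℕ} {y : ℤ → ℤ} (h : IsNodes M y) (k : ℕ) (x : unitInterval) :
    ((gridSelf h)^[k] x : ℝ) = (gridMap M y)^[k] x := by
  induction k with
  | zero => rfl
  | succ k ih =>
    rw [Function.iterate_succ_apply', Function.iterate_succ_apply', ← ih]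
    rfl

lemma exists_cell_subset {M : ℕ} (hM : 0 < M) {J : Set unitInterval} (ho : IsOpen J)
    (hn : J.Nonempty) :
    ∃ (n : ℕ) (i : ℤ), (0 ≤ i ∧ i < (6 ^ n * M : ℕ)) ∧
      ∀ x : unitInterval, (x : ℝ) ∈ cell (6 ^ n * M) i → x ∈ J := by
  obtain ⟨x, hx⟩ := hn
  obtain ⟨ε, hε, hball⟩ := Metric.isOpen_iff.1 ho x hx
  obtain ⟨n, hn⟩ := exists_pow_lt_of_lt_one hε (by norm_num : (1 / 6 : ℝ) < 1)
  have hpos : 0 < 6 ^ n * M := by positivity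
  obtain ⟨i, h0, h1, hi⟩ := exists_cell hpos x.2.1 x.2.2
  refine ⟨n, i, ⟨h0, h1⟩, fun z hz => hball ?_⟩
  rw [Metric.mem_ball, Subtype.dist_eq]
  refine lt_of_le_of_lt (Real.dist_le_of_mem_Icc hz hi) (lt_of_le_of_lt ?_ hn)
  have hM1 : (1 : ℝ) ≤ M := by exact_mod_cast hM
  rw [← sub_div, add_sub_cancel_left, one_div_pow]
  refine one_div_le_one_div_of_le (by positivity) ?_
  push_cast
  exact le_mul_of_one_le_right (by positivity) hM1

lemma Primitive.exists_iterate_image_eq_univ {M : ℕ} {y : ℤ → ℤ} (h : IsNodes M y)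
    (hp : Primitive M y) {J : Set unitInterval} (ho : IsOpen J) (hn : J.Nonempty) :
    ∃ n : ℕ, (gridSelf h)^[n] '' J = Set.univ := by
  obtain ⟨n, i, ⟨h0, h1⟩, hJ⟩ := exists_cell_subset h.1 ho hn
  obtain ⟨h', hg⟩ := _root_.iterate_refine h n
  obtain ⟨k, -, hk⟩ := hp.iterate_refine h n i h0 h1
  refine ⟨k, eq_univ_of_forall fun z => ?_⟩
  obtain ⟨j, j0, j1, hj⟩ := exists_cell h'.1 z.2.1 z.2.2
  obtain ⟨w, hw, hwz⟩ := (hk j j0 j1).cell_subset h' h0 h1 hj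
  rw [hg] at hwz
  refine ⟨⟨w, cell_subset_unit h'.1 h0 h1 hw⟩, hJ _ hw, Subtype.ext ?_⟩
  rw [coe_iterate_gridSelf]
  exact hwz

/-- The points of the unit interval that follow a cycle of cells periodically. -/
def follow (M : ℕ) (y : ℤ → ℤ) (m : ℕ) (c : ℕ → ℤ) : Set unitInterval :=
  Subtype.val ⁻¹' followers (gridMap M y) M m c

lemma isClosed_follow (M : ℕ) (y : ℤ → ℤ) (m : ℕ) (c : ℕ → ℤ) : IsClosed (follow M y m c) := by
  refine IsClosed.preimage continuous_subtype_val ?_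
  have hc := continuous_gridMap M y
  have : followers (gridMap M y) M m c = {x | (gridMap M y)^[m] x = x} ∩
      ⋂ j ∈ {j | j < m}, (gridMap M y)^[j] ⁻¹' cell M (c j) := by
    ext x
    simp [followers]
  rw [this]
  exact (isClosed_eq (hc.iterate m) continuous_id).inter
    (isClosed_biInter fun j _ => isClosed_Icc.preimage (hc.iterate j))

lemma follow_subset_fixSet {M : ℕ} {y : ℤ → ℤ} (h : IsNodes M y) (m : ℕ) (c : ℕ → ℤ) :
    follow M y m c ⊆ FixSet (gridSelf h) m := fun x hx => Subtype.ext (by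
  rw [coe_iterate_gridSelf]
  exact hx.1)

lemma IsCycle.not_countable_follow {M : ℕ} {y : ℤ → ℤ} (h : IsNodes M y) {m : ℕ} {c : ℕ → ℤ}
    (hc : IsCycle M y m c) (hm : 0 < m) : ¬ (follow M y m c).Countable := by
  intro hcount
  refine hc.not_countable_followers h hm ((hcount.image Subtype.val).mono fun x hx => ?_)
  have hx0 : x ∈ Icc (0 : ℝ) 1 :=
    cell_subset_unit h.1 (hc.2 0 hm).1 (hc.2 0 hm).2.1 (hx.2 0 hm)
  exact ⟨⟨x, hx0⟩, hx, rfl⟩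

lemma IsCycle.exists_periodicMeasure_pos {M : ℕ} {y : ℤ → ℤ} (h : IsNodes M y) {m : ℕ}
    {c : ℕ → ℤ} (hc : IsCycle M y m c) (hm : 0 < m) :
    ∃ μ, PeriodicMeasure (gridSelf h) μ ∧ 0 < μ (follow M y m c) :=
  _root_.exists_periodicMeasure_pos (gridSelf h).continuous hm (follow_subset_fixSet h m c)
    (isClosed_follow M y m c) (hc.not_countable_follow h hm)

/-- A cycle supports a periodic measure giving each visited cell its visiting frequency. -/
lemma IsCycle.exists_periodicMeasure {M : ℕ} {y : ℤ → ℤ} (h : IsNodes M y) {m : ℕ}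
    {c : ℕ → ℤ} (hc : IsCycle M y m c) (hm : 0 < m) :
    ∃ μ, PeriodicMeasure (gridSelf h) μ ∧ ∀ k : ℤ, μ {x : unitInterval | (x : ℝ) ≤ k / M} =
      (m : ENNReal)⁻¹ * ∑ j ∈ Finset.range m, if c j < k then 1 else 0 := by
  have hg := (gridSelf h).continuous
  have hM' : (0 : ℝ) < M := by exact_mod_cast h.1
  obtain ⟨ν, h1, h2, h3⟩ := exists_atomless_measure (isClosed_follow M y m c)
    (hc.not_countable_follow h hm)
  have hσ := periodicMeasure_orbitAverage hg hm (follow_subset_fixSet h m c) h1 h2 h3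
  refine ⟨_, hσ, fun k => ?_⟩
  have hcell : ∀ x ∈ follow M y m c, ∀ j < m, ((gridSelf h)^[j] x : ℝ) ∈ cell M (c j) := by
    intro x hx j hj
    rw [coe_iterate_gridSelf]
    exact hx.2 j hj
  have hmle : MeasurableSet {x : unitInterval | (x : ℝ) ≤ k / M} :=
    measurableSet_le measurable_subtype_coe measurable_const
  have hmlt : MeasurableSet {x : unitInterval | (x : ℝ) < k / M} :=
    measurableSet_lt measurable_subtype_coe measurable_const
  refine le_antisymm ?_ ?_
  · calc orbitAverage (gridSelf h) m ν {x : unitInterval | (x : ℝ) ≤ k / M}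
        ≤ orbitAverage (gridSelf h) m ν ({x : unitInterval | (x : ℝ) < k / M} ∪
          {x : unitInterval | (x : ℝ) = k / M}) := measure_mono fun x hx => by
            rcases (show (x : ℝ) ≤ k / M from hx).lt_or_eq with hx | hx
            · exact Or.inl hx
            · exact Or.inr hx
      _ ≤ _ := measure_union_le _ _
      _ = orbitAverage (gridSelf h) m ν {x : unitInterval | (x : ℝ) < k / M} := by
        have : {x : unitInterval | (x : ℝ) = k / M}.Subsingleton := fun s hs t ht =>
          Subtype.ext ((show (s : ℝ) = _ from hs).trans (show (t : ℝ) = _ from ht).symm)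
        rcases this.eq_empty_or_singleton with e | ⟨p, e⟩
        · rw [e, measure_empty, add_zero]
        · rw [e, hσ.mass_singleton, add_zero]
      _ ≤ _ := by
        rw [orbitAverage_apply hg m ν hmlt]
        gcongr with j hj
        have hj := Finset.mem_range.1 hj
        split_ifs with hk
        · rw [← h1]
          exact measure_mono (subset_univ _)
        · rw [← measure_empty (μ := ν)]
          refine measure_congr_of_compl_null h3 fun x hx hxk => ?_
          have e1 := (hcell x hx j hj).1
          have e2 : ((gridSelf h)^[j] x : ℝ) < k / M := hxk
          have e3 : (k : ℝ) / M ≤ c j / M := by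
            gcongr
            exact_mod_cast not_lt.1 hk
          linarith
  · rw [orbitAverage_apply hg m ν hmle]
    gcongr with j hj
    have hj := Finset.mem_range.1 hj
    split_ifs with hk
    · rw [← h1]
      refine measure_congr_of_compl_null h3 fun x hx _ => ?_
      have e1 := (hcell x hx j hj).2
      refine e1.trans ?_
      gcongr
      exact_mod_cast hk
    · exact zero_le

/-- A primitive node sequence admits a periodic measure of full support. -/
lemma Primitive.exists_periodicMeasure_pos_cell {M : ℕ} {y : ℤ → ℤ} (h : IsNodes M y)
    (hp : Primitive M y) (n : ℕ) {i : ℤ} (h0 : 0 ≤ i) (h1 : i < (6 ^ n * M : ℕ)) :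
    ∃ μ, PeriodicMeasure (gridSelf h) μ ∧
      0 < μ {x : unitInterval | (x : ℝ) ∈ cell (6 ^ n * M) i} := by
  obtain ⟨h', hg⟩ := _root_.iterate_refine h n
  obtain ⟨k, hk, hr⟩ := hp.iterate_refine h n i h0 h1
  obtain ⟨c, c0, ck, hc⟩ := (hr i h0 h1).exists_path h' h0 h1
  have hc' : IsCycle (6 ^ n * M) (refineNodes^[n] y) k c := ⟨ck.trans c0.symm, hc⟩
  obtain ⟨μ, hμ, hpos⟩ := hc'.exists_periodicMeasure_pos h' hk
  have e : gridSelf h' = gridSelf h := by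
    ext x
    exact congrFun hg x
  rw [e] at hμ
  refine ⟨μ, hμ, hpos.trans_le (measure_mono fun x hx => ?_)⟩
  have := hx.2 0 hk
  rwa [c0] at this

lemma exists_periodicMeasure_pos_perSet {M : ℕ} {y : ℤ → ℤ} (h : IsNodes M y) {a b : ℤ}
    (ha0 : 0 ≤ a) (ha1 : a < M) (hb0 : 0 ≤ b) (hb1 : b < M) (hab : a + 1 < b ∨ b + 1 < a)
    (haa : Arrow y a a) (hab' : Arrow y a b) (hba : Arrow y b a) {k : ℕ} (hk : 1 ≤ k) :
    ∃ μ, PeriodicMeasure (gridSelf h) μ ∧ 0 < μ (PerSet (gridSelf h) k) := by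
  have hM' : (0 : ℝ) < M := by exact_mod_cast h.1
  have key : ∀ c : ℕ → ℤ, IsCycle M y k c →
      (∀ x ∈ follow M y k c, ∀ i : ℕ, 1 ≤ i → i < k → (gridSelf h)^[i] x ≠ x) →
      ∃ μ, PeriodicMeasure (gridSelf h) μ ∧ 0 < μ (PerSet (gridSelf h) k) := by
    intro c hc hx
    obtain ⟨μ, hμ, hpos⟩ := hc.exists_periodicMeasure_pos h hk
    exact ⟨μ, hμ, hpos.trans_le (measure_mono fun x hxc =>
      ⟨follow_subset_fixSet h k c hxc, hx x hxc⟩)⟩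
  rcases hk.eq_or_lt with rfl | hk
  · exact key (fun _ => a) ⟨rfl, fun j _ => ⟨ha0, ha1, haa⟩⟩ (by omega)
  · refine key (fun j => if j = 0 ∨ j = k then b else a) ⟨by simp, fun j hj => ?_⟩
      fun x hx i hi hik hxi => ?_
    · by_cases h0 : j = 0
      · subst h0
        have : (1 : ℕ) ≠ k := by omega
        simp [hb0, hb1, this, hba]
      · have h1 : j ≠ k := by omega
        by_cases h2 : j + 1 = k
        · simp [h0, h1, h2, ha0, ha1, hab']
        · simp [h0, h1, h2, ha0, ha1, haa]
    · have e1 := hx.2 0 (by omega)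
      have e2 := hx.2 i hik
      rw [← coe_iterate_gridSelf h, hxi] at e2
      have hi0 : i ≠ 0 := by omega
      have hik' : i ≠ k := by omega
      simp only [true_or, if_true, Function.iterate_zero, id, hi0, hik', or_self, if_false] at e1 e2
      obtain ⟨l1, r1⟩ := e1
      obtain ⟨l2, r2⟩ := e2
      rcases hab with hab | hab
      · have : (a + 1 : ℝ) / M < b / M := by
          gcongr
          exact_mod_cast hab
        linarith
      · have : (b + 1 : ℝ) / M < a / M := by
          gcongr
          exact_mod_cast hab
        linarith

/-- If a permutation of the cells follows the arrows, there is a periodic measure giving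
each cell the same mass. -/
lemma exists_periodicMeasure_uniform {M : ℕ} {y : ℤ → ℤ} (h : IsNodes M y)
    (π : Equiv.Perm (Fin M)) (hπ : ∀ i : Fin M, Arrow y (i : ℕ) (π i : ℕ)) :
    ∃ μ, PeriodicMeasure (gridSelf h) μ ∧ ∀ k : ℕ, k ≤ M →
      μ {x : unitInterval | (x : ℝ) ≤ k / M} = ENNReal.ofReal (k / M) := by
  have hM' : (0 : ℝ) < M := by exact_mod_cast h.1
  have hM0 : (M : ENNReal) ≠ 0 := by exact_mod_cast h.1.ne'
  set m := orderOf π with hm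
  have hm0 : 0 < m := orderOf_pos π
  have hm0' : (m : ENNReal) ≠ 0 := by exact_mod_cast hm0.ne'
  have hcyc : ∀ i : Fin M, IsCycle M y m fun j => (((π ^ j) i : Fin M) : ℕ) := by
    intro i
    refine ⟨by simp [hm, pow_orderOf_eq_one], fun j _ => ⟨by positivity, ?_, ?_⟩⟩
    · exact Nat.cast_lt.2 ((π ^ j) i).2
    · beta_reduce
      rw [pow_succ', Equiv.Perm.mul_apply]
      exact hπ _
  choose ρ hρ hmass using fun i => (hcyc i).exists_periodicMeasure h hm0
  have hw : ∑' _ : Fin M, (M : ENNReal)⁻¹ = 1 := by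
    rw [tsum_fintype, Finset.sum_const, Finset.card_univ, Fintype.card_fin, nsmul_eq_mul]
    exact ENNReal.mul_inv_cancel hM0 (ENNReal.natCast_ne_top M)
  refine ⟨_, PeriodicMeasure.sum (gridSelf h).continuous hw hρ, fun k hk => ?_⟩
  have hcount : ∀ j : ℕ, ∑ i : Fin M, (if ((((π ^ j) i : Fin M) : ℕ) : ℤ) < (k : ℤ)
      then (1 : ENNReal) else 0) = k := by
    intro j
    rw [Equiv.sum_comp (π ^ j) fun i : Fin M => if ((i : ℕ) : ℤ) < (k : ℤ) then (1 : ENNReal) else 0]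
    rw [Fin.sum_univ_eq_sum_range (fun i : ℕ => if (i : ℤ) < (k : ℤ) then (1 : ENNReal) else 0)]
    rw [Finset.sum_boole]
    have : (Finset.range M).filter (fun i : ℕ => (i : ℤ) < (k : ℤ)) = Finset.range k := by
      ext i
      simp only [Finset.mem_filter, Finset.mem_range]
      omega
    rw [this, Finset.card_range]
  have hms : MeasurableSet {x : unitInterval | (x : ℝ) ≤ k / M} :=
    measurableSet_le measurable_subtype_coe measurable_const
  rw [Measure.sum_apply _ hms, tsum_fintype]
  have hmass' : ∀ i, ρ i {x : unitInterval | (x : ℝ) ≤ k / M} = _ := fun i => hmass i k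
  simp only [Measure.smul_apply, smul_eq_mul, hmass']
  rw [← Finset.mul_sum, ← Finset.mul_sum, Finset.sum_comm]
  simp only [hcount]
  rw [Finset.sum_const, Finset.card_range, nsmul_eq_mul, ← mul_assoc (m : ENNReal)⁻¹,
    ENNReal.inv_mul_cancel hm0' (ENNReal.natCast_ne_top m), one_mul,
    ENNReal.ofReal_div_of_pos hM', ENNReal.ofReal_natCast, ENNReal.ofReal_natCast,
    ENNReal.div_eq_inv_mul]

lemma abs_measure_Iic_sub_le {M : ℕ} (hM : 0 < M) {μ : Measure unitInterval} (h1 : μ univ = 1)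
    (h : ∀ k : ℕ, k ≤ M → μ {x : unitInterval | (x : ℝ) ≤ k / M} = ENNReal.ofReal (k / M))
    (x : unitInterval) : |(μ (Iic x)).toReal - x| ≤ 1 / M := by
  have hM' : (0 : ℝ) < M := by exact_mod_cast hM
  have : IsProbabilityMeasure μ := ⟨h1⟩
  obtain ⟨i, h0, h1, hi⟩ := exists_cell hM x.2.1 x.2.2
  lift i to ℕ using h0
  have hiM : i < M := by exact_mod_cast h1
  obtain ⟨ha, hb⟩ := hi
  rw [Int.cast_natCast] at ha hb
  have e1 : (i : ℝ) / M ≤ (μ (Iic x)).toReal := by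
    rw [← ENNReal.ofReal_le_iff_le_toReal (measure_ne_top _ _), ← h i hiM.le]
    exact measure_mono fun z hz => Subtype.coe_le_coe.1 (le_trans hz ha)
  have e2 : (μ (Iic x)).toReal ≤ (i + 1) / M := by
    refine ENNReal.toReal_le_of_le_ofReal (by positivity) ?_
    have := h (i + 1) hiM
    push_cast at this
    rw [← this]
    exact measure_mono fun z hz => le_trans (Subtype.coe_le_coe.2 (mem_Iic.1 hz)) hb
  rw [add_div] at e2 hb
  rw [abs_le]
  constructor <;> linarith

lemma exists_periodicMeasure_near {M : ℕ} {y : ℤ → ℤ} (h : IsNodes M y) (hp : Primitive M y)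
    (π : Equiv.Perm (Fin M)) (hπ : ∀ i : Fin M, Arrow y (i : ℕ) (π i : ℕ)) {a b : ℤ}
    (ha0 : 0 ≤ a) (ha1 : a < M) (hb0 : 0 ≤ b) (hb1 : b < M) (hab : a + 1 < b ∨ b + 1 < a)
    (haa : Arrow y a a) (hab' : Arrow y a b) (hba : Arrow y b a) {t : ℝ} (ht0 : 0 < t)
    (ht1 : t ≤ 1) :
    ∃ μ, PeriodicMeasure (gridSelf h) μ ∧ (∀ U, IsOpen U → U.Nonempty → 0 < μ U) ∧
      (∀ k, 1 ≤ k → 0 < μ (PerSet (gridSelf h) k)) ∧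
      ∀ x : unitInterval, |(μ (Iic x)).toReal - x| ≤ 1 / M + t := by
  obtain ⟨μ₀, hμ₀, hmass⟩ := exists_periodicMeasure_uniform h π hπ
  let ι := (Σ n : ℕ, {i : ℤ // 0 ≤ i ∧ i < (6 ^ n * M : ℕ)}) ⊕ ℕ
  let X : ι → Set unitInterval := Sum.elim
    (fun p => {x : unitInterval | (x : ℝ) ∈ cell (6 ^ p.1 * M) p.2.1})
    (fun k => PerSet (gridSelf h) (k + 1))
  obtain ⟨μ₁, hμ₁, hpos⟩ := exists_periodicMeasure_pos_of_countable (X := X)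
    (gridSelf h).continuous (by
      rintro (⟨n, i, h0, h1⟩ | k)
      · exact hp.exists_periodicMeasure_pos_cell h n h0 h1
      · exact exists_periodicMeasure_pos_perSet h ha0 ha1 hb0 hb1 hab haa hab' hba
          (Nat.le_add_left 1 k))
  have hw : ENNReal.ofReal (1 - t) + ENNReal.ofReal t = 1 := by
    rw [← ENNReal.ofReal_add (by linarith) ht0.le]
    simp
  have hle : ∀ A, 0 < μ₁ A → 0 < (ENNReal.ofReal (1 - t) • μ₀ + ENNReal.ofReal t • μ₁) A := by
    intro A hA
    simp only [Measure.add_apply, Measure.smul_apply, smul_eq_mul]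
    exact lt_of_lt_of_le (ENNReal.mul_pos (ENNReal.ofReal_pos.2 ht0).ne' hA.ne') le_add_self
  refine ⟨_, hμ₀.add hw hμ₁, fun U hU hn => hle _ ?_, fun k hk => hle _ ?_, fun x => ?_⟩
  · obtain ⟨n, i, hi, hsub⟩ := exists_cell_subset h.1 hU hn
    exact (hpos (Sum.inl ⟨n, i, hi⟩)).trans_le (measure_mono hsub)
  · obtain ⟨k, rfl⟩ := Nat.exists_eq_add_of_le' hk
    exact hpos (Sum.inr k)
  · have p0 : IsProbabilityMeasure μ₀ := ⟨hμ₀.mass_univ⟩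
    have p1 : IsProbabilityMeasure μ₁ := ⟨hμ₁.mass_univ⟩
    have e := abs_le.1 (abs_measure_Iic_sub_le h.1 hμ₀.mass_univ hmass x)
    simp only [Measure.add_apply, Measure.smul_apply, smul_eq_mul]
    rw [ENNReal.toReal_add (by finiteness) (by finiteness), ENNReal.toReal_mul,
      ENNReal.toReal_mul, ENNReal.toReal_ofReal (by linarith), ENNReal.toReal_ofReal ht0.le]
    have a0 : 0 ≤ (μ₀ (Iic x)).toReal := ENNReal.toReal_nonneg
    have a1 : (μ₀ (Iic x)).toReal ≤ 1 := measureReal_le_one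
    have b0 : 0 ≤ (μ₁ (Iic x)).toReal := ENNReal.toReal_nonneg
    have b1 : (μ₁ (Iic x)).toReal ≤ 1 := measureReal_le_one
    rw [abs_le]
    constructor <;> nlinarith

/-- `F` maps into `[0, 1]` and the mesh `1 / N` is fine relative to the tolerance `κ`. -/
structure FineMesh (F : ℝ → ℝ) (N : ℕ) (κ : ℝ) : Prop where
  pos : 0 < κ
  four_le : 4 ≤ N
  twelve_le : 12 ≤ N * κ
  mem : ∀ x, F x ∈ Icc (0 : ℝ) 1
  close : ∀ u v : ℝ, |u - v| ≤ 3 / N → |F u - F v| ≤ κ / 4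

/-- The node sequence zigzagging around `F`: low at even nodes, high at odd ones. -/
def zigzagNodes (F : ℝ → ℝ) (N : ℕ) (κ : ℝ) (i : ℤ) : ℤ :=
  if Even i then ⌊(N : ℝ) * max 0 (F (i / N) - κ)⌋ else ⌈(N : ℝ) * min 1 (F (i / N) + κ)⌉

namespace FineMesh

variable {F : ℝ → ℝ} {N : ℕ} {κ : ℝ}

lemma natCast_pos (h : FineMesh F N κ) : (0 : ℝ) < N := by
  have : 0 < N := by have := h.four_le; omega
  exact_mod_cast this

lemma inv_le (h : FineMesh F N κ) : 1 / N ≤ κ / 12 := by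
  rw [div_le_div_iff₀ h.natCast_pos (by norm_num)]
  linarith [h.twelve_le]

lemma dist_le_of_mem_cell (h : FineMesh F N κ) {i p : ℤ} (hp : p = i ∨ p = i + 1) {x : ℝ}
    (hx : x ∈ cell N i) : |F (p / N) - F x| ≤ κ / 4 := by
  have hN := h.natCast_pos
  obtain ⟨h1, h2⟩ := hx
  refine h.close _ _ ?_
  have e1 : ((i : ℝ) + 1) / N = i / N + 1 / N := by ring
  have e2 : (3 : ℝ) / N = 3 * (1 / N) := by ring
  have e3 : (0 : ℝ) < 1 / N := by positivity
  rw [abs_le]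
  rcases hp with rfl | rfl
  · constructor <;> linarith
  · push_cast
    constructor <;> linarith

lemma arrow (h : FineMesh F N κ) {i j : ℤ} (j0 : 0 ≤ j) (j1 : j < N) {x : ℝ}
    (hx : x ∈ cell N i) (hj : |F x - j / N| ≤ κ / 2) : Arrow (zigzagNodes F N κ) i j := by
  have hN := h.natCast_pos
  have hκ := h.pos
  have j0' : (0 : ℝ) ≤ j := by exact_mod_cast j0
  have j1' : (j : ℝ) < N := by exact_mod_cast j1
  have hjN : (N : ℝ) * (j / N) = j := by field_simp
  have low : ∀ p : ℤ, (p = i ∨ p = i + 1) → Even p → zigzagNodes F N κ p ≤ j := by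
    intro p hp he
    have := abs_le.1 (h.dist_le_of_mem_cell hp hx)
    have := abs_le.1 hj
    rw [zigzagNodes, if_pos he]
    have : (N : ℝ) * max 0 (F (p / N) - κ) ≤ j := by
      rw [← hjN]
      refine mul_le_mul_of_nonneg_left (max_le (by positivity) (by linarith)) hN.le
    exact_mod_cast (Int.floor_le _).trans this
  have high : ∀ p : ℤ, (p = i ∨ p = i + 1) → ¬ Even p → j < zigzagNodes F N κ p := by
    intro p hp he
    have := abs_le.1 (h.dist_le_of_mem_cell hp hx)
    have := abs_le.1 hj
    rw [zigzagNodes, if_neg he, Int.lt_ceil, ← hjN]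
    refine mul_lt_mul_of_pos_left (lt_min ?_ (by linarith)) hN
    rwa [div_lt_one hN]
  by_cases he : Even i
  · have he' : ¬ Even (i + 1) := by simpa [Int.even_add_one] using he
    exact ⟨(min_le_left _ _).trans (low i (Or.inl rfl) he),
      (high _ (Or.inr rfl) he').trans_le (le_max_right _ _)⟩
  · have he' : Even (i + 1) := by simpa [Int.even_add_one] using he
    exact ⟨(min_le_right _ _).trans (low _ (Or.inr rfl) he'),
      (high _ (Or.inl rfl) he).trans_le (le_max_left _ _)⟩

lemma abs_sub_le_of_mem_cell (h : FineMesh F N κ) {j : ℤ} {x : ℝ} (hx : x ∈ cell N j) :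
    |x - j / N| ≤ 1 / N := by
  obtain ⟨h1, h2⟩ := hx
  rw [add_div] at h2
  have : (0 : ℝ) < 1 / N := by have := h.natCast_pos; positivity
  rw [abs_le]
  constructor <;> linarith

lemma isNodes (h : FineMesh F N κ) : IsNodes N (zigzagNodes F N κ) := by
  have hN := h.natCast_pos
  have hκ := h.pos
  have hN0 : 0 < N := by exact_mod_cast hN
  refine ⟨hN0, fun i _ _ => ?_, fun i h0 h1 => ?_⟩
  · obtain ⟨m0, m1⟩ := h.mem (i / N)
    rw [zigzagNodes]
    split_ifs
    · have e1 : (N : ℝ) * max 0 (F (i / N) - κ) ≤ N :=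
        mul_le_of_le_one_right hN.le (max_le zero_le_one (by linarith))
      exact ⟨Int.floor_nonneg.2 (by positivity), by exact_mod_cast (Int.floor_le _).trans e1⟩
    · have e1 : (N : ℝ) * min 1 (F (i / N) + κ) ≤ N :=
        mul_le_of_le_one_right hN.le (min_le_left _ _)
      refine ⟨Int.ceil_nonneg (mul_nonneg hN.le (le_min zero_le_one (by linarith))), ?_⟩
      rw [Int.ceil_le]
      exact_mod_cast e1
  · obtain ⟨j, j0, j1, hj⟩ := exists_cell hN0 (h.mem (i / N)).1 (h.mem (i / N)).2
    have ha : Arrow (zigzagNodes F N κ) i j := h.arrow j0 j1 (x := i / N)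
      ⟨le_rfl, by gcongr; linarith⟩
      ((h.abs_sub_le_of_mem_cell hj).trans (by linarith [h.inv_le]))
    intro e
    obtain ⟨a1, a2⟩ := ha
    omega

lemma abs_zigzagNodes_sub_le (h : FineMesh F N κ) (i : ℤ) :
    |(zigzagNodes F N κ i : ℝ) / N - F (i / N)| ≤ κ + 1 / N := by
  have hN := h.natCast_pos
  have hκ := h.pos
  obtain ⟨m0, m1⟩ := h.mem (i / N)
  have hN1 : (0 : ℝ) < 1 / N := by positivity
  rw [zigzagNodes]
  split_ifs
  · set s := max 0 (F (i / N) - κ) with hs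
    have s1 : F (i / N) - κ ≤ s := le_max_right _ _
    have s2 : s ≤ F (i / N) := max_le m0 (by linarith)
    have f1 : (⌊(N : ℝ) * s⌋ : ℝ) / N ≤ s := by
      rw [div_le_iff₀ hN, mul_comm]; exact Int.floor_le _
    have f2 : s - 1 / N ≤ (⌊(N : ℝ) * s⌋ : ℝ) / N := by
      rw [le_div_iff₀ hN, sub_mul, one_div_mul_cancel hN.ne']
      linarith [Int.lt_floor_add_one ((N : ℝ) * s)]
    rw [abs_le]
    constructor <;> linarith
  · set s := min 1 (F (i / N) + κ) with hs
    have s1 : s ≤ F (i / N) + κ := min_le_right _ _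
    have s2 : F (i / N) ≤ s := le_min m1 (by linarith)
    have f1 : s ≤ (⌈(N : ℝ) * s⌉ : ℝ) / N := by
      rw [le_div_iff₀ hN, mul_comm]; exact Int.le_ceil _
    have f2 : (⌈(N : ℝ) * s⌉ : ℝ) / N ≤ s + 1 / N := by
      rw [div_le_iff₀ hN, add_mul, one_div_mul_cancel hN.ne']
      linarith [Int.ceil_lt_add_one ((N : ℝ) * s)]
    rw [abs_le]
    constructor <;> linarith

lemma abs_gridMap_sub_le (h : FineMesh F N κ) {x : ℝ} (hx : x ∈ Icc (0 : ℝ) 1) :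
    |gridMap N (zigzagNodes F N κ) x - F x| ≤ 2 * κ := by
  have hN := h.natCast_pos
  have hN0 : 0 < N := by exact_mod_cast hN
  have hκ := h.pos
  obtain ⟨i, h0, h1, hi⟩ := exists_cell hN0 hx.1 hx.2
  obtain ⟨g1, g2⟩ := gridMap_mem_Icc hN0 (zigzagNodes F N κ) h0 h1 hi
  have near : ∀ p : ℤ, (p = i ∨ p = i + 1) →
      |(zigzagNodes F N κ p : ℝ) / N - F x| ≤ 2 * κ := by
    intro p hp
    have e1 := abs_le.1 (h.dist_le_of_mem_cell hp hi)
    have e2 := abs_le.1 (h.abs_zigzagNodes_sub_le p)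
    have := h.inv_le
    rw [abs_le]
    constructor <;> linarith
  have n1 := abs_le.1 (near i (Or.inl rfl))
  have n2 := abs_le.1 (near (i + 1) (Or.inr rfl))
  rw [abs_le]
  constructor
  · rcases min_choice (zigzagNodes F N κ i) (zigzagNodes F N κ (i + 1)) with e | e <;>
      rw [e] at g1 <;> linarith
  · rcases max_choice (zigzagNodes F N κ i) (zigzagNodes F N κ (i + 1)) with e | e <;>
      rw [e] at g2 <;> linarith

lemma primitive (h : FineMesh F N κ) (hF : ∀ a b : ℝ, 0 ≤ a → a < b → b ≤ 1 →
      ∃ u v, b - a ≤ v - u ∧ 0 ≤ u ∧ v ≤ 1 ∧ ∀ δ s, 0 ≤ δ → u - δ ≤ s → s ≤ v + δ →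
        ∃ x ∈ Icc a b, |F x - s| ≤ δ) :
    Primitive N (zigzagNodes F N κ) := by
  have hN := h.natCast_pos
  have hN0 : 0 < N := by exact_mod_cast hN
  have hκ := h.pos
  intro i i0 i1
  suffices H : ∀ k : ℕ, ∃ a b : ℤ, 0 ≤ a ∧ a < b ∧ b ≤ N ∧ min (N : ℤ) (k + 1) ≤ b - a ∧
      ∀ j, a ≤ j → j < b → Reach (zigzagNodes F N κ) k i j by
    obtain ⟨a, b, a0, hab, bN, hk, hr⟩ := H N
    refine ⟨N, hN0, fun j j0 j1 => hr j ?_ ?_⟩ <;> omega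
  intro k
  induction k with
  | zero => exact ⟨i, i + 1, i0, by omega, by omega, by push_cast; omega, fun j h1 h2 => by
      show i = j
      omega⟩
  | succ k ih =>
    obtain ⟨a, b, a0, hab, bN, hk, hr⟩ := ih
    have a0' : (0 : ℝ) ≤ a := by exact_mod_cast a0
    have hab' : (a : ℝ) < b := by exact_mod_cast hab
    have bN' : (b : ℝ) ≤ N := by exact_mod_cast bN
    obtain ⟨u, v, huv, u0, v1, hcov⟩ := hF (a / N) (b / N) (by positivity) (by gcongr)
      ((div_le_one hN).2 bN')
    rw [← sub_div, div_le_iff₀ hN] at huv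
    have hc := Int.ceil_lt_add_one ((N : ℝ) * (u - κ / 2))
    have hc' := Int.le_ceil ((N : ℝ) * (u - κ / 2))
    have hf := Int.lt_floor_add_one ((N : ℝ) * (v + κ / 2))
    have hf' := Int.floor_le ((N : ℝ) * (v + κ / 2))
    set A := ⌈(N : ℝ) * (u - κ / 2)⌉
    set B := ⌊(N : ℝ) * (v + κ / 2)⌋
    have h12 := h.twelve_le
    have i1 : b - a < B + 1 := by
      have : ((b - a : ℤ) : ℝ) < ((B + 1 : ℤ) : ℝ) := by push_cast; nlinarith
      exact_mod_cast this
    have i2 : b - a < N - A := by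
      have : ((b - a : ℤ) : ℝ) < ((N - A : ℤ) : ℝ) := by push_cast; nlinarith
      exact_mod_cast this
    have i3 : b - a < B + 1 - A := by
      have : ((b - a : ℤ) : ℝ) < ((B + 1 - A : ℤ) : ℝ) := by push_cast; nlinarith
      exact_mod_cast this
    refine ⟨max 0 A, min N (B + 1), le_max_left _ _, by omega, min_le_left _ _, by
      push_cast; omega, fun j h1 h2 => ?_⟩
    have j0 : 0 ≤ j := (le_max_left _ _).trans h1
    have j1 : j < N := h2.trans_le (min_le_left _ _)
    have jA : (A : ℝ) ≤ j := by exact_mod_cast (le_max_right _ _).trans h1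
    have jB : (j : ℝ) ≤ B := by exact_mod_cast (by omega : j ≤ B)
    obtain ⟨x, ⟨x1, x2⟩, hx⟩ := hcov (κ / 2) (j / N) (by positivity)
      (by rw [le_div_iff₀ hN]; linarith) (by rw [div_le_iff₀ hN]; linarith)
    obtain ⟨l, l1, l2, hl⟩ : ∃ l : ℤ, a ≤ l ∧ l < b ∧ x ∈ cell N l := by
      rw [div_le_iff₀ hN] at x1
      rw [le_div_iff₀ hN] at x2
      rcases x2.lt_or_eq with x2 | x2
      · refine ⟨⌊x * N⌋, Int.le_floor.2 x1, Int.floor_lt.2 x2, ?_, ?_⟩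
        · rw [div_le_iff₀ hN]; exact Int.floor_le _
        · rw [le_div_iff₀ hN]; exact (Int.lt_floor_add_one _).le
      · refine ⟨b - 1, by omega, by omega, ?_, ?_⟩
        · rw [div_le_iff₀ hN]; push_cast; linarith
        · rw [le_div_iff₀ hN]; push_cast; linarith
    exact ⟨l, hr l l1 l2, h.arrow j0 j1 hl hx⟩

lemma exists_loop (h : FineMesh F N κ) {z : ℝ} (hz : z ∈ Icc (0 : ℝ) 1) (hfix : F z = z) :
    ∃ a b : ℤ, 0 ≤ a ∧ a < N ∧ 0 ≤ b ∧ b < N ∧ (a + 1 < b ∨ b + 1 < a) ∧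
      Arrow (zigzagNodes F N κ) a a ∧ Arrow (zigzagNodes F N κ) a b ∧
      Arrow (zigzagNodes F N κ) b a := by
  have hN := h.natCast_pos
  have hN0 : 0 < N := by exact_mod_cast hN
  have hN1 : (0 : ℝ) < 1 / N := by positivity
  have hκ := h.pos
  have h4 := h.four_le
  have hinv := h.inv_le
  obtain ⟨a, a0, a1, ha⟩ := exists_cell hN0 hz.1 hz.2
  have hza := abs_le.1 (h.abs_sub_le_of_mem_cell ha)
  obtain ⟨b, b0, b1, hb⟩ : ∃ b : ℤ, 0 ≤ b ∧ b < N ∧ (b = a + 2 ∨ b = a - 2) := by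
    by_cases h2 : 2 ≤ a
    · exact ⟨a - 2, by omega, by omega, Or.inr rfl⟩
    · exact ⟨a + 2, by omega, by omega, Or.inl rfl⟩
  have hzb : |z - b / N| ≤ 3 * (1 / N) := by
    rw [abs_le]
    rcases hb with rfl | rfl
    · have : ((a + 2 : ℤ) : ℝ) / N = a / N + 2 * (1 / N) := by push_cast; ring
      rw [this]
      constructor <;> linarith
    · have : ((a - 2 : ℤ) : ℝ) / N = a / N - 2 * (1 / N) := by push_cast; ring
      rw [this]
      constructor <;> linarith
  have hzb' := abs_le.1 hzb
  refine ⟨a, b, a0, a1, b0, b1, by omega, h.arrow a0 a1 ha ?_, h.arrow b0 b1 ha ?_,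
    h.arrow a0 a1 (x := b / N) ⟨le_rfl, by gcongr; linarith⟩ ?_⟩
  · rw [hfix, abs_le]
    constructor <;> linarith
  · rw [hfix, abs_le]
    constructor <;> linarith
  · have := abs_le.1 (h.close z (b / N) (hzb.trans_eq (mul_one_div _ _)))
    rw [hfix] at this
    rw [abs_le]
    constructor <;> linarith

end FineMesh

lemma lebI_preimage_coe (A : Set ℝ) : lebI (Subtype.val ⁻¹' A) = volume (Icc 0 1 ∩ A) := by
  rw [lebI, unitInterval.measurableEmbedding_coe.comap_apply, Subtype.image_preimage_coe]

/-- The extension to the real line of a self-map of the unit interval. -/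
def lineExtend (f : C(unitInterval, unitInterval)) (x : ℝ) : ℝ := f (projIcc 0 1 zero_le_one x)

lemma lineExtend_coe (f : C(unitInterval, unitInterval)) (x : unitInterval) : lineExtend f x = f x := by
  rw [lineExtend, projIcc_val]

lemma continuous_lineExtend (f : C(unitInterval, unitInterval)) : Continuous (lineExtend f) :=
  continuous_subtype_val.comp (f.continuous.comp continuous_projIcc)

/-- The image of an interval under a measure-preserving map is at least as long. -/
lemma MeasPres.exists_image_interval {f : C(unitInterval, unitInterval)} (hf : MeasPres f)
    {a b : ℝ} (ha : 0 ≤ a) (hab : a < b) (hb : b ≤ 1) :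
    ∃ u v, b - a ≤ v - u ∧ 0 ≤ u ∧ v ≤ 1 ∧ ∀ δ s, 0 ≤ δ → u - δ ≤ s → s ≤ v + δ →
      ∃ x ∈ Icc a b, |lineExtend f x - s| ≤ δ := by
  have hc := continuous_lineExtend f
  obtain ⟨p, hp, hpm⟩ := isCompact_Icc.exists_isMinOn (nonempty_Icc.2 hab.le) hc.continuousOn
  obtain ⟨q, hq, hqm⟩ := isCompact_Icc.exists_isMaxOn (nonempty_Icc.2 hab.le) hc.continuousOn
  have hu : 0 ≤ lineExtend f p := (f (projIcc 0 1 zero_le_one p)).2.1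
  have hv : lineExtend f q ≤ 1 := (f (projIcc 0 1 zero_le_one q)).2.2
  have hpq : lineExtend f p ≤ lineExtend f q := hpm hq
  refine ⟨lineExtend f p, lineExtend f q, ?_, hu, hv, fun δ s hδ h1 h2 => ?_⟩
  · have hsub : (Subtype.val ⁻¹' Icc a b : Set unitInterval) ⊆
        f ⁻¹' (Subtype.val ⁻¹' Icc (lineExtend f p) (lineExtend f q)) := by
      intro x hx
      rw [mem_preimage, mem_preimage, ← lineExtend_coe]
      exact ⟨hpm hx, hqm hx⟩
    have hle : lebI (Subtype.val ⁻¹' Icc a b) ≤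
        lebI (Subtype.val ⁻¹' Icc (lineExtend f p) (lineExtend f q)) := by
      rw [← hf (Subtype.val ⁻¹' Icc (lineExtend f p) (lineExtend f q))
        (measurable_subtype_coe measurableSet_Icc)]
      exact measure_mono hsub
    rw [lebI_preimage_coe, lebI_preimage_coe, inter_eq_right.2 (Icc_subset_Icc ha hb),
      inter_eq_right.2 (Icc_subset_Icc hu hv), Real.volume_Icc, Real.volume_Icc,
      ENNReal.ofReal_le_ofReal_iff (by linarith)] at hle
    exact hle
  · rcases lt_or_ge s (lineExtend f p) with h3 | h3
    · exact ⟨p, hp, by rw [abs_le]; constructor <;> linarith⟩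
    rcases lt_or_ge (lineExtend f q) s with h4 | h4
    · exact ⟨q, hq, by rw [abs_le]; constructor <;> linarith⟩
    obtain ⟨x, hx, rfl⟩ := isPreconnected_Icc.intermediate_value hp hq hc.continuousOn ⟨h3, h4⟩
    exact ⟨x, hx, by simpa using hδ⟩

lemma volume_cell {N : ℕ} (hN : 0 < N) (i : ℤ) : volume (cell N i) = (N : ENNReal)⁻¹ := by
  have hN' : (0 : ℝ) < N := by exact_mod_cast hN
  rw [cell, Real.volume_Icc, ← sub_div, add_sub_cancel_left, one_div,
    ENNReal.ofReal_inv_of_pos hN', ENNReal.ofReal_natCast]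

lemma volume_biUnion_cell {N : ℕ} (hN : 0 < N) (S : Finset (Fin N)) :
    volume (⋃ i ∈ S, cell N (i : ℕ)) = S.card * (N : ENNReal)⁻¹ := by
  have hN' : (0 : ℝ) < N := by exact_mod_cast hN
  refine le_antisymm ?_ ?_
  · refine (measure_biUnion_finset_le S _).trans ?_
    simp only [volume_cell hN, Finset.sum_const, nsmul_eq_mul, le_refl]
  · calc (S.card : ENNReal) * (N : ENNReal)⁻¹
        = ∑ i ∈ S, volume (Ico (((i : ℕ) : ℝ) / N) (((i : ℕ) + 1 : ℝ) / N)) := by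
          simp only [Real.volume_Ico, ← Real.volume_Icc]
          have := fun i : Fin N => volume_cell hN (i : ℕ)
          simp only [cell, Int.cast_natCast] at this
          simp only [this, Finset.sum_const, nsmul_eq_mul]
      _ = volume (⋃ i ∈ S, Ico (((i : ℕ) : ℝ) / N) (((i : ℕ) + 1 : ℝ) / N)) := by
          refine (measure_biUnion_finset (fun i _ j _ hij => ?_) fun i _ => measurableSet_Ico).symm
          rw [Function.onFun, Set.disjoint_left]
          rintro x ⟨h1, h2⟩ ⟨h3, h4⟩
          rw [div_le_iff₀ hN'] at h1 h3
          rw [lt_div_iff₀ hN'] at h2 h4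
          have e1 : (i : ℕ) < (j : ℕ) + 1 := by exact_mod_cast h1.trans_lt h4
          have e2 : (j : ℕ) < (i : ℕ) + 1 := by exact_mod_cast h3.trans_lt h2
          exact hij (Fin.ext (by omega))
      _ ≤ _ := measure_mono (iUnion₂_mono fun i _ => by
          simpa only [cell, Int.cast_natCast] using Ico_subset_Icc_self)

/-- A measure-preserving map induces a permutation of the cells, by Hall's theorem. -/
lemma MeasPres.exists_perm {f : C(unitInterval, unitInterval)} (hf : MeasPres f) {N : ℕ}
    (hN : 0 < N) : ∃ π : Equiv.Perm (Fin N), ∀ i : Fin N, ∃ x : unitInterval,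
      (x : ℝ) ∈ cell N (i : ℕ) ∧ (f x : ℝ) ∈ cell N (π i : ℕ) := by
  classical
  have hN0 : (N : ENNReal) ≠ 0 := by exact_mod_cast hN.ne'
  let t : Fin N → Finset (Fin N) := fun i => Finset.univ.filter fun j =>
    ∃ x : unitInterval, (x : ℝ) ∈ cell N (i : ℕ) ∧ (f x : ℝ) ∈ cell N (j : ℕ)
  have hunit : ∀ S : Finset (Fin N), (⋃ i ∈ S, cell N (i : ℕ)) ⊆ Icc 0 1 := fun S =>
    iUnion₂_subset fun i _ => cell_subset_unit hN (by positivity) (Nat.cast_lt.2 i.2)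
  obtain ⟨p, hp, hpt⟩ := (Finset.all_card_le_biUnion_card_iff_exists_injective t).1 (by
    intro S
    have hsub : (Subtype.val ⁻¹' (⋃ i ∈ S, cell N (i : ℕ)) : Set unitInterval) ⊆
        f ⁻¹' (Subtype.val ⁻¹' (⋃ j ∈ S.biUnion t, cell N (j : ℕ))) := by
      intro x hx
      simp only [mem_preimage, mem_iUnion] at hx ⊢
      obtain ⟨i, hi, hx⟩ := hx
      obtain ⟨j, j0, j1, hj⟩ := exists_cell hN (f x).2.1 (f x).2.2
      lift j to ℕ using j0
      refine ⟨⟨j, Nat.cast_lt.1 j1⟩, ?_, hj⟩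
      rw [Finset.mem_biUnion]
      exact ⟨i, hi, Finset.mem_filter.2 ⟨Finset.mem_univ _, x, hx, hj⟩⟩
    have hmeas : MeasurableSet (⋃ j ∈ S.biUnion t, cell N (j : ℕ)) :=
      Finset.measurableSet_biUnion _ fun _ _ => measurableSet_Icc
    have hle := measure_mono (μ := lebI) hsub
    rw [hf _ (measurable_subtype_coe hmeas), lebI_preimage_coe, lebI_preimage_coe,
      inter_eq_right.2 (hunit _), inter_eq_right.2 (hunit _), volume_biUnion_cell hN,
      volume_biUnion_cell hN, ENNReal.mul_le_mul_iff_left (ENNReal.inv_ne_zero.2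
        (ENNReal.natCast_ne_top N)) (ENNReal.inv_ne_top.2 hN0)] at hle
    exact_mod_cast hle)
  refine ⟨Equiv.ofBijective p (Finite.injective_iff_bijective.1 hp), fun i => ?_⟩
  exact (Finset.mem_filter.1 (hpt i)).2

lemma exists_fineMesh (f : C(unitInterval, unitInterval)) {κ : ℝ} (hκ : 0 < κ) :
    ∃ N, FineMesh (lineExtend f) N κ := by
  obtain ⟨δ, hδ, hfδ⟩ := Metric.uniformContinuous_iff.1
    (CompactSpace.uniformContinuous_of_continuous f.continuous) (κ / 4) (by positivity)
  obtain ⟨N, hN⟩ := exists_nat_gt (max 4 (max (12 / κ) (3 / δ)))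
  simp only [max_lt_iff] at hN
  obtain ⟨n1, n2, n3⟩ := hN
  have hN' : (0 : ℝ) < N := by linarith
  refine ⟨N, hκ, ?_, ?_, fun x => (f _).2, fun u v huv => ?_⟩
  · exact_mod_cast n1.le
  · rw [div_lt_iff₀ hκ] at n2
    exact n2.le
  · have h1 : (3 : ℝ) / N < δ := by
      rw [div_lt_iff₀ hδ] at n3
      rw [div_lt_iff₀ hN']
      linarith
    have h2 : dist (projIcc (0 : ℝ) 1 zero_le_one u) (projIcc 0 1 zero_le_one v) ≤ |u - v| :=
      abs_projIcc_sub_projIcc _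
    exact (hfδ (h2.trans_lt (huv.trans_lt h1))).le

lemma exists_fixedPoint_lineExtend (f : C(unitInterval, unitInterval)) :
    ∃ z ∈ Icc (0 : ℝ) 1, lineExtend f z = z := by
  have hc : ContinuousOn (fun x => lineExtend f x - x) (Icc 0 1) :=
    ((continuous_lineExtend f).sub continuous_id).continuousOn
  have h0 : 0 ≤ lineExtend f 0 := (f (projIcc 0 1 zero_le_one 0)).2.1
  have h1 : lineExtend f 1 ≤ 1 := (f (projIcc 0 1 zero_le_one 1)).2.2
  obtain ⟨z, hz, hfz⟩ := isPreconnected_Icc.intermediate_value (right_mem_Icc.2 zero_le_one)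
    (left_mem_Icc.2 zero_le_one) hc (show (0 : ℝ) ∈ Icc _ _ from
      ⟨by linarith, by linarith⟩)
  exact ⟨z, hz, sub_eq_zero.1 hfz⟩

theorem dense_leo_full_measure_periodic :
    Dense {f : ↥CLam |
      Leo (⇑f.1) ∧
      lebI (⋃ k ∈ {k : ℕ | 1 ≤ k}, PerSet (⇑f.1) k) = 1 ∧
      ∀ k : ℕ, 1 ≤ k → 0 < lebI (PerSet (⇑f.1) k)} := by
  rw [Metric.dense_iff]
  rintro ⟨f₀, hf₀⟩ ε hε
  have hmp : MeasPres f₀ := hf₀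
  obtain ⟨N, hmesh⟩ := exists_fineMesh f₀ (κ := ε / 4) (by positivity)
  have hN := hmesh.natCast_pos
  have hnodes := hmesh.isNodes
  have hprim := hmesh.primitive fun a b => hmp.exists_image_interval
  obtain ⟨π, hπ⟩ := hmp.exists_perm hnodes.1
  have harrow : ∀ i : Fin N, Arrow (zigzagNodes (lineExtend f₀) N (ε / 4)) (i : ℕ) (π i : ℕ) := by
    intro i
    obtain ⟨x, hx, hfx⟩ := hπ i
    refine hmesh.arrow (by positivity) (Nat.cast_lt.2 (π i).2) hx ?_
    rw [lineExtend_coe]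
    exact (hmesh.abs_sub_le_of_mem_cell hfx).trans (by linarith [hmesh.inv_le])
  obtain ⟨z, hz, hfix⟩ := exists_fixedPoint_lineExtend f₀
  obtain ⟨a, b, a0, a1, b0, b1, hab, haa, hab', hba⟩ := hmesh.exists_loop hz hfix
  have hinv := hmesh.inv_le
  have hN1 : (0 : ℝ) < 1 / N := by positivity
  have hN2 : 1 / (N : ℝ) ≤ 1 := by
    rw [div_le_one hN]
    exact_mod_cast hnodes.1
  obtain ⟨μ, hμ, hopen, hper, hnear⟩ := exists_periodicMeasure_near hnodes hprim π harrow a0 a1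
    b0 b1 hab haa hab' hba hN1 hN2
  obtain ⟨f, hf, hprop, h, hh, hconj⟩ := hμ.exists_conjugate hopen
    (fun J ho hn => hprim.exists_iterate_image_eq_univ hnodes ho hn) hper
  refine ⟨⟨f, hf⟩, ?_, hprop⟩
  rw [Metric.mem_ball, Subtype.dist_eq]
  refine (ContinuousMap.dist_le (C := 3 * (ε / 4)) (by positivity)).2 (fun w => ?_) |>.trans_lt
    (by linarith)
  obtain ⟨x, rfl⟩ := h.surjective w
  have hx : ∀ x, |(h x : ℝ) - x| ≤ 2 * (1 / N) := fun x => by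
    rw [hh]
    exact (hnear x).trans_eq (by ring)
  have d1 := abs_le.1 (hx (gridSelf hnodes x))
  have d2 := abs_le.1 (hmesh.abs_gridMap_sub_le x.2)
  have d3 := abs_le.1 (hmesh.close (h x) x ((hx x).trans (by
    rw [div_eq_mul_one_div (3 : ℝ)]
    linarith)))
  rw [lineExtend_coe, lineExtend_coe] at d3
  rw [lineExtend_coe] at d2
  have d4 : ((gridSelf hnodes x : unitInterval) : ℝ) = gridMap N _ x := rfl
  rw [d4] at d1
  show dist (f (h x)) (f₀ (h x)) ≤ _
  rw [hconj, Subtype.dist_eq, Real.dist_eq, abs_le]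
  constructor <;> linarith
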